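/- arXiv:1710.07719 — 3 statements merged into one kernel-verified Lean document; each statement's English description precedes it below -/
import Mathlib

section
/- There exist constants Γ > 0 and ε₀ > 0 (depending only on a_1, a_2, a_3) such that for all 0 < ε ≤ ε₀, with n_ε = ⌈1/ε²⌉ and k_ε = ⌈n_ε/2⌉, one has Γ/ε ≤ V_off^*(n_ε, k_ε) − V_on^*(n_ε, k_ε). In particular, sup_{(n,k)∈𝒯} {V_off^*(n,k) − V_on^*(n,k)} ≥ Γ/ε for all 0 < ε ≤ ε₀. -/
open MeasureTheory ProbabilityTheory Finset

noncomputable section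

namespace MultiSecretary

variable {Ω : Type*}

/-- `Z_j^r`: the number of candidates with ability `aj` among the first `r`
(candidates are indexed `0, 1, …`, so `X 0, …, X (r-1)` are the first `r`). -/
def Zc (X : ℕ → Ω → ℝ) (aj : ℝ) (r : ℕ) (ω : Ω) : ℝ :=
  ∑ t ∈ range r, if X t ω = aj then 1 else 0

/-- `F̄(a_j) = f_1 + ⋯ + f_{j-1}`. -/
def Fbar (f : ℕ → ℝ) (j : ℕ) : ℝ := ∑ i ∈ Icc 1 (j - 1), f i

/-- The offline-sort count `𝔖_j^r = min { Z_j^r , (k - ∑_{i<j} Z_i^r)_+ }`. -/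
def Soff (a : ℕ → ℝ) (X : ℕ → Ω → ℝ) (k r j : ℕ) (ω : Ω) : ℝ :=
  min (Zc X (a j) r ω) (max ((k : ℝ) - ∑ i ∈ Icc 1 (j - 1), Zc X (a i) r ω) 0)

/-- The offline value `V_off^*(n,k) = ∑_j a_j E[𝔖_j^n]`. -/
def Voff [MeasurableSpace Ω] (μ : Measure Ω) (m : ℕ) (a : ℕ → ℝ) (X : ℕ → Ω → ℝ)
    (n k : ℕ) : ℝ :=
  ∑ j ∈ Icc 1 m, a j * ∫ ω, Soff a X k n j ω ∂μ

/-- The σ-field `𝓕_t` generated by the first `t` pairs `(X_s, U_s)`. -/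
def Fil (X U : ℕ → Ω → ℝ) (t : ℕ) : MeasurableSpace Ω :=
  MeasurableSpace.comap (fun ω => fun s : Fin t => (X s ω, U s ω)) inferInstance

/-- A feasible online policy for the `(n,k)` multi-secretary problem: `σp t` is the
(0/1-valued) decision about candidate `t` (0-indexed), measurable with respect to
`𝓕_{t+1} = σ(X_0,U_0,…,X_t,U_t)`, and at most `k` candidates are selected. -/
def IsPolicy (X U : ℕ → Ω → ℝ) (n k : ℕ) (σp : ℕ → Ω → ℕ) : Prop :=
  (∀ t ω, σp t ω ≤ 1) ∧
  (∀ t, Measurable[Fil X U (t + 1)] (σp t)) ∧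
  (∀ ω, ∑ t ∈ range n, σp t ω ≤ k)

/-- The value `V_on^π(n,k)` of an online policy. -/
def Von [MeasurableSpace Ω] (μ : Measure Ω) (X : ℕ → Ω → ℝ) (n : ℕ) (σp : ℕ → Ω → ℕ) : ℝ :=
  ∫ ω, (∑ t ∈ range n, X t ω * (σp t ω : ℝ)) ∂μ

/-- `V_on^*(n,k)`, the optimal value over feasible online policies. -/
def VonStar [MeasurableSpace Ω] (μ : Measure Ω) (X U : ℕ → Ω → ℝ) (n k : ℕ) : ℝ :=
  sSup {v : ℝ | ∃ σp, IsPolicy X U n k σp ∧ v = Von μ X n σp}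

/-- `S_j^{π,r}`: the number of `a_j`-candidates selected by policy `π` among the first `r`. -/
def Spol (a : ℕ → ℝ) (X : ℕ → Ω → ℝ) (σp : ℕ → Ω → ℕ) (j r : ℕ) (ω : Ω) : ℝ :=
  ∑ t ∈ range r, (σp t ω : ℝ) * (if X t ω = a j then 1 else 0)

/-- The Budget-Ratio thresholds: `T_1 = 0`, `T_j = (F̄(a_j)+F̄(a_{j+1}))/2` for `j ≥ 2`. -/
def Tthr (f : ℕ → ℝ) (j : ℕ) : ℝ := if j = 1 then 0 else (Fbar f j + Fbar f (j + 1)) / 2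

/-- The index `j ∈ [m]` with `T_j ≤ x < T_{j+1}` (with `T_{m+1} = ∞`), i.e. the largest
`j ∈ [m]` with `T_j ≤ x`. -/
def jBR (m : ℕ) (f : ℕ → ℝ) (x : ℝ) : ℕ :=
  ((Icc 1 m).filter fun j => Tthr f j ≤ x).sup id

/-- The remaining-budget process `K_t` of the Budget-Ratio policy: `K_0 = k`, and the
candidate `X_t` (presented at time `t+1`, 1-indexed) is selected iff `K_t > 0` and
`X_t > a_{j+1}` where `T_j ≤ K_t/(n-t) < T_{j+1}` (for `j = m`, i.e. `T_m ≤ K_t/(n-t)`,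
every candidate is selected since `T_{m+1} = ∞` and `a_{m+1} < a_m`). -/
def Kbr (m : ℕ) (a f : ℕ → ℝ) (X : ℕ → Ω → ℝ) (n k : ℕ) : ℕ → Ω → ℕ
  | 0, _ => k
  | t + 1, ω =>
    Kbr m a f X n k t ω -
      (if 0 < Kbr m a f X n k t ω ∧
          (jBR m f ((Kbr m a f X n k t ω : ℝ) / ((n : ℝ) - t)) = m ∨
            a (jBR m f ((Kbr m a f X n k t ω : ℝ) / ((n : ℝ) - t)) + 1) < X t ω)
        then 1 else 0)

/-- The selection decisions `σ^br` of the Budget-Ratio policy (0-indexed candidates). -/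
def σbr (m : ℕ) (a f : ℕ → ℝ) (X : ℕ → Ω → ℝ) (n k : ℕ) (t : ℕ) (ω : Ω) : ℕ :=
  Kbr m a f X n k t ω - Kbr m a f X n k (t + 1) ω

/-- The Bernoulli selection indicators `B_t` of a non-adaptive policy `p = (p_{j,t})`. -/
def Bna (m : ℕ) (a : ℕ → ℝ) (p : ℕ → ℕ → ℝ) (X U : ℕ → Ω → ℝ) (t : ℕ) (ω : Ω) : ℝ :=
  ∑ j ∈ Icc 1 m, if U t ω ≤ p j t ∧ X t ω = a j then 1 else 0

/-- The stopping time `ν = min{ r ≥ 1 : B_1 + ⋯ + B_r ≥ k or r ≥ n }` of a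
non-adaptive policy. -/
def nuNA (m : ℕ) (a : ℕ → ℝ) (p : ℕ → ℕ → ℝ) (X U : ℕ → Ω → ℝ) (n k : ℕ) (ω : Ω) : ℕ :=
  sInf {r : ℕ | 1 ≤ r ∧ ((k : ℝ) ≤ ∑ t ∈ range r, Bna m a p X U t ω ∨ n ≤ r)}

/-- The value `V_on^π(n,k) = ∑_j a_j E[∑_{t ≤ ν} B_t 1(X_t = a_j)]` of a non-adaptive policy. -/
def VonNA [MeasurableSpace Ω] (μ : Measure Ω) (m : ℕ) (a : ℕ → ℝ) (p : ℕ → ℕ → ℝ)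
    (X U : ℕ → Ω → ℝ) (n k : ℕ) : ℝ :=
  ∑ j ∈ Icc 1 m, a j *
    ∫ ω, (∑ t ∈ range (nuNA m a p X U n k ω), if X t ω = a j then Bna m a p X U t ω else 0) ∂μ

/-- `V_na^*(n,k)`: the optimal value over non-adaptive policies. -/
def VnaStar [MeasurableSpace Ω] (μ : Measure Ω) (m : ℕ) (a : ℕ → ℝ) (X U : ℕ → Ω → ℝ)
    (n k : ℕ) : ℝ :=
  sSup {v : ℝ | ∃ p : ℕ → ℕ → ℝ,
    (∀ j t, 0 ≤ p j t ∧ p j t ≤ 1) ∧ v = VonNA μ m a p X U n k}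

/-- The deterministic relaxation `DR(n,k)`. -/
def DRval (m : ℕ) (a f : ℕ → ℝ) (n k : ℕ) : ℝ :=
  sSup {v : ℝ | ∃ s : ℕ → ℝ,
    (∀ j ∈ Icc 1 m, 0 ≤ s j ∧ s j ≤ (n : ℝ) * f j) ∧
    (∑ j ∈ Icc 1 m, s j) ≤ (k : ℝ) ∧ v = ∑ j ∈ Icc 1 m, a j * s j}

/-- The optimal solution `s_j^* = min{ n f_j, (k - n F̄(a_j))_+ }` of the deterministic
relaxation. -/
def sStar (f : ℕ → ℝ) (n k j : ℕ) : ℝ :=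
  min ((n : ℝ) * f j) (max ((k : ℝ) - (n : ℝ) * Fbar f j) 0)

/-- `J0Spec m f n k j` says that `j = j₀(n,k)`, the action index of `(n,k)`. -/
def J0Spec (m : ℕ) (f : ℕ → ℝ) (n k j : ℕ) : Prop :=
  (j = 1 ∧ (k : ℝ) / (n : ℝ) < f 1 + f 2 / 2) ∨
  (1 ≤ j ∧ j + 1 ≤ m ∧ Fbar f j + f j / 2 ≤ (k : ℝ) / (n : ℝ) ∧
    (k : ℝ) / (n : ℝ) < Fbar f (j + 2) - f (j + 1) / 2) ∨
  (j = m ∧ 1 - f m / 2 ≤ (k : ℝ) / (n : ℝ))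

/-- The budget ratio `K_t / (n - t)`. -/
def ratio (K : ℕ → Ω → ℕ) (n t : ℕ) (ω : Ω) : ℝ := (K t ω : ℝ) / ((n : ℝ) - t)

/-- The time `τ₀` at which the budget ratio first enters the `δ/2`-orbit of a threshold
(or the deterministic time `n - 2δ⁻¹ - 1` is reached). -/
def tau0 (m : ℕ) (f : ℕ → ℝ) (δ : ℝ) (K : ℕ → Ω → ℕ) (n : ℕ) (ω : Ω) : ℕ :=
  sInf {t : ℕ |
    (∃ j ∈ Icc 1 m, |ratio K n t ω - Tthr f j| ≤ δ / 2) ∨ (n : ℝ) - 2 / δ - 1 ≤ (t : ℝ)}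

/-- The index `j(τ₀)` of the threshold entered at time `τ₀` (set to `m+1`, corresponding to
`T_{j(τ₀)} = ∞`, when `τ₀ ≥ n - 2δ⁻¹ - 1`). -/
def jTau0 (m : ℕ) (f : ℕ → ℝ) (δ : ℝ) (K : ℕ → Ω → ℕ) (n : ℕ) (ω : Ω) : ℕ :=
  if (tau0 m f δ K n ω : ℝ) < (n : ℝ) - 2 / δ - 1 then
    sInf {j : ℕ | j ∈ Icc 1 m ∧ |ratio K n (tau0 m f δ K n ω) ω - Tthr f j| ≤ δ / 2}
  else m + 1

/-- The exit time `τ = inf{ t > τ₀ : |K_t/(n-t) - T_{j(τ₀)}| > δ or t ≥ n - 2δ⁻¹ - 1 }`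
(for `j(τ₀) = m + 1`, i.e. `T_{j(τ₀)} = ∞`, the first condition is vacuous). -/
def tauBR (m : ℕ) (f : ℕ → ℝ) (δ : ℝ) (K : ℕ → Ω → ℕ) (n : ℕ) (ω : Ω) : ℕ :=
  sInf {t : ℕ | tau0 m f δ K n ω < t ∧
    ((n : ℝ) - 2 / δ - 1 ≤ (t : ℝ) ∨
      (jTau0 m f δ K n ω ≤ m ∧ δ < |ratio K n t ω - Tthr f (jTau0 m f δ K n ω)|))}

/-- The deviation process `Y_u = K_{τ₀+u} - T_{j(τ₀)} (n - τ₀ - u)`. -/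
def Ydev (m : ℕ) (f : ℕ → ℝ) (δ : ℝ) (K : ℕ → Ω → ℕ) (n : ℕ) (u : ℕ) (ω : Ω) : ℝ :=
  (K (tau0 m f δ K n ω + u) ω : ℝ) -
    Tthr f (jTau0 m f δ K n ω) * ((n : ℝ) - (tau0 m f δ K n ω : ℝ) - (u : ℝ))

/-- The minimal mass `min{f_1, …, f_m}` of the ability distribution. -/
def minf (m : ℕ) (f : ℕ → ℝ) : ℝ := sInf {x : ℝ | ∃ j, 1 ≤ j ∧ j ≤ m ∧ x = f j}

/-- The standing model hypotheses of the multi-secretary problem: the abilities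
`0 < a_m < ⋯ < a_1`, the probability mass function `f`, and the i.i.d. sequence of
abilities `X_t` together with the auxiliary i.i.d. uniform randomization variables `U_t`. -/
structure Model [MeasurableSpace Ω] (μ : Measure Ω) (m : ℕ) (a f : ℕ → ℝ)
    (X U : ℕ → Ω → ℝ) : Prop where
  hm : 1 ≤ m
  ha_anti : ∀ j, 1 ≤ j → j < m → a (j + 1) < a j
  ha_pos : 0 < a m
  hf_pos : ∀ j, 1 ≤ j → j ≤ m → 0 < f j
  hf_sum : ∑ j ∈ Icc 1 m, f j = 1
  hprob : IsProbabilityMeasure μ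
  hXmeas : ∀ t, Measurable (X t)
  hUmeas : ∀ t, Measurable (U t)
  hXdist : ∀ t j, 1 ≤ j → j ≤ m → μ {ω | X t ω = a j} = ENNReal.ofReal (f j)
  hUdist : ∀ t, μ.map (U t) = volume.restrict (Set.Icc (0 : ℝ) 1)
  hIndep : iIndepFun (fun t ω => (X t ω, U t ω)) μ
  hXUIndep : ∀ t, IndepFun (X t) (U t) μ

/-- The standing model hypotheses with only the ability sequence `X` (no auxiliary
randomization). -/
structure ModelX [MeasurableSpace Ω] (μ : Measure Ω) (m : ℕ) (a f : ℕ → ℝ)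
    (X : ℕ → Ω → ℝ) : Prop where
  hm : 1 ≤ m
  ha_anti : ∀ j, 1 ≤ j → j < m → a (j + 1) < a j
  ha_pos : 0 < a m
  hf_pos : ∀ j, 1 ≤ j → j ≤ m → 0 < f j
  hf_sum : ∑ j ∈ Icc 1 m, f j = 1
  hprob : IsProbabilityMeasure μ
  hXmeas : ∀ t, Measurable (X t)
  hXdist : ∀ t j, 1 ≤ j → j ≤ m → μ {ω | X t ω = a j} = ENNReal.ofReal (f j)
  hIndep : iIndepFun X μ


section Aux

variable [MeasurableSpace Ω] {μ : Measure Ω} [IsProbabilityMeasure μ]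

lemma cheb_aux {B : ℕ → Ω → ℝ} {q : ℝ} (hB : ∀ t, Measurable (B t)) (hI : iIndepFun B μ)
    (h01 : ∀ t ω, B t ω ∈ Set.Icc (0 : ℝ) 1) (hq : ∀ t, ∫ ω, B t ω ∂μ = q)
    (F : Finset ℕ) {c : ℝ} (hc : 0 < c) :
    μ.real {ω | c ≤ |∑ t ∈ F, B t ω - F.card * q|} ≤ F.card * (q * (1 - q)) / c ^ 2 := by
  have hL : ∀ t, MemLp (B t) 2 μ := fun t => by
    refine MemLp.of_bound (hB t).aestronglyMeasurable 1 (Filter.Eventually.of_forall fun ω => ?_)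
    rw [Real.norm_eq_abs, abs_le]
    have := h01 t ω
    exact ⟨by linarith [this.1], this.2⟩
  have hS : MemLp (∑ t ∈ F, B t) 2 μ := memLp_finsetSum' _ fun i _ => hL i
  have hm : ∫ ω, (∑ t ∈ F, B t) ω ∂μ = F.card * q := by
    simp only [Finset.sum_apply]
    rw [integral_finsetSum _ fun i _ => (hL i).integrable (by norm_num)]
    simp [hq]
  have hv : Var[∑ t ∈ F, B t; μ] ≤ F.card * (q * (1 - q)) := by
    rw [IndepFun.variance_sum (fun i _ => hL i) (fun i _ j _ hij => hI.indepFun hij)]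
    rw [← nsmul_eq_mul]
    refine Finset.sum_le_card_nsmul _ _ _ fun t _ => ?_
    have := variance_le_sub_mul_sub (μ := μ) (a := 0) (b := 1) (X := B t)
      (Filter.Eventually.of_forall (h01 t)) (hB t).aemeasurable
    rw [hq] at this
    linarith
  have h := meas_ge_le_variance_div_sq hS hc
  rw [hm] at h
  simp only [Finset.sum_apply] at h
  have h2 : μ.real {ω | c ≤ |∑ t ∈ F, B t ω - F.card * q|} ≤ Var[∑ t ∈ F, B t; μ] / c ^ 2 := by
    rw [Measure.real]
    exact ENNReal.toReal_le_of_le_ofReal (by have := variance_nonneg (∑ t ∈ F, B t) μ; positivity) h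
  exact h2.trans (by gcongr)

lemma hoeff_aux {B : ℕ → Ω → ℝ} {q : ℝ} (hB : ∀ t, Measurable (B t)) (hI : iIndepFun B μ)
    (h01 : ∀ t ω, B t ω ∈ Set.Icc (0 : ℝ) 1) (hq : ∀ t, ∫ ω, B t ω ∂μ = q)
    (F : Finset ℕ) {c : ℝ} (hc : 0 ≤ c) :
    μ.real {ω | F.card * c ≤ ∑ t ∈ F, B t ω - F.card * q} ≤ Real.exp (-(2 * c ^ 2)) ^ F.card := by
  have hsub : ∀ t ∈ F, HasSubgaussianMGF (fun ω => B t ω - q) ((‖(1:ℝ) - 0‖₊ / 2) ^ 2) μ := by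
    intro t _
    have := hasSubgaussianMGF_of_mem_Icc (μ := μ) (hB t).aemeasurable
      (Filter.Eventually.of_forall (h01 t))
    rwa [hq] at this
  have hI' : iIndepFun (fun t ω => B t ω - q) μ :=
    hI.comp (fun _ x => x - q) fun _ => measurable_id.sub_const q
  have := HasSubgaussianMGF.measure_sum_ge_le_of_iIndepFun hI' hsub
    (ε := F.card * c) (by positivity)
  simp only [Finset.sum_sub_distrib, Finset.sum_const, nsmul_eq_mul] at this
  refine this.trans ?_
  rw [← Real.exp_nat_mul]
  apply Real.exp_le_exp.2
  rcases Nat.eq_zero_or_pos F.card with h | h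
  · simp [h]
  · have : (0 : ℝ) < F.card := by exact_mod_cast h
    apply le_of_eq
    simp
    field_simp

lemma pz_aux {B : ℕ → Ω → ℝ} {ε : ℝ} (h0 : 0 < ε) (hε : ε ≤ 1 / 100)
    (hB : ∀ t, Measurable (B t)) (hI : iIndepFun B μ)
    (h01 : ∀ t ω, B t ω = 0 ∨ B t ω = 1) (hq : ∀ t, ∫ ω, B t ω ∂μ = 1 / 2 - 4 * ε)
    (F : Finset ℕ) (hF1 : 1 / 2 ≤ ε ^ 2 * F.card) (hF2 : ε ^ 2 * F.card ≤ 1) :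
    Real.exp (-20000) / 4 ≤ μ.real {ω | 7 / ε ≤ ∑ t ∈ F, (2 * B t ω - 1)} := by
  set Y : ℕ → Ω → ℝ := fun t ω => 2 * B t ω - 1 with hY
  have hYm : ∀ t, Measurable (Y t) := fun t => ((hB t).const_mul 2).sub_const 1
  have hIY : iIndepFun Y μ :=
    hI.comp (fun _ x => 2 * x - 1) fun _ => (measurable_id.const_mul 2).sub_const 1
  have hBi : ∀ t, Integrable (B t) μ := fun t =>
    Integrable.of_bound (hB t).aestronglyMeasurable 1 (Filter.Eventually.of_forall fun ω => by
      rcases h01 t ω with h | h <;> simp [h])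
  have hmgf : ∀ θ t, mgf (Y t) μ θ = Real.cosh θ - 8 * ε * Real.sinh θ := by
    intro θ t
    have : ∀ ω, Real.exp (θ * Y t ω) = B t ω * (Real.exp θ - Real.exp (-θ)) + Real.exp (-θ) := by
      intro ω
      rcases h01 t ω with h | h <;> simp [hY, h]
      norm_num
    simp only [mgf, this]
    rw [integral_add ((hBi t).mul_const _) (integrable_const _), integral_mul_const, hq]
    simp [Real.cosh_eq, Real.sinh_eq]
    ring
  set S : Ω → ℝ := ∑ t ∈ F, Y t with hS
  have hSm : ∀ θ, mgf S μ θ = (Real.cosh θ - 8 * ε * Real.sinh θ) ^ F.card := by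
    intro θ
    rw [hS, hIY.mgf_sum hYm]
    simp [hmgf]
  have hSmeas : Measurable S := by
    have := Finset.measurable_sum F fun t _ => hYm t
    convert this using 1
    ext ω
    simp [hS]
  have hSb : ∀ ω, |S ω| ≤ F.card := by
    intro ω
    simp only [hS, Finset.sum_apply]
    refine (Finset.abs_sum_le_sum_abs _ _).trans ?_
    have := Finset.sum_le_card_nsmul F (fun t => |Y t ω|) 1 (fun t _ => by
      rcases h01 t ω with h | h <;> simp [hY, h]; norm_num)
    simpa using this
  have hEi : ∀ θ, Integrable (fun ω => Real.exp (θ * S ω)) μ := by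
    intro θ
    refine Integrable.of_bound (by fun_prop) (Real.exp (|θ| * F.card))
      (Filter.Eventually.of_forall fun ω => ?_)
    rw [Real.norm_eq_abs, Real.abs_exp]
    apply Real.exp_le_exp.2
    calc θ * S ω ≤ |θ * S ω| := le_abs_self _
      _ = |θ| * |S ω| := abs_mul _ _
      _ ≤ _ := by gcongr; exact hSb ω
  have hN : (0:ℝ) ≤ F.card := by positivity
  -- first moment
  have hM1 : Real.exp (850) ≤ mgf S μ (100 * ε) := by
    rw [hSm]
    have hs : Real.sinh (100 * ε) ≤ 2 * (100 * ε) := by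
      have hx : |100 * ε| ≤ 1 := by rw [abs_of_pos (by positivity)]; linarith
      have h1 := Real.abs_exp_sub_one_sub_id_le hx
      have h2 := Real.abs_exp_sub_one_sub_id_le (x := -(100 * ε)) (by rwa [abs_neg])
      rw [Real.sinh_eq]
      rw [abs_le] at h1 h2
      nlinarith [h1.2, h2.1]
    have hc : 1 + (100 * ε) ^ 2 / 2 ≤ Real.cosh (100 * ε) := by
      have h1 := Real.cosh_sq' (50 * ε)
      have h2 := Real.cosh_two_mul (50 * ε)
      have h3 : 50 * ε ≤ Real.sinh (50 * ε) := Real.self_le_sinh_iff.2 (by positivity)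
      have : 100 * ε = 2 * (50 * ε) := by ring
      rw [this, h2]
      nlinarith
    have hu : Real.exp (1700 * ε ^ 2) ≤ Real.cosh (100 * ε) - 8 * ε * Real.sinh (100 * ε) := by
      have h1 : 1 + 3400 * ε ^ 2 ≤ Real.cosh (100 * ε) - 8 * ε * Real.sinh (100 * ε) := by
        nlinarith
      refine le_trans ?_ h1
      have hx : |1700 * ε ^ 2| ≤ 1 := by rw [abs_of_pos (by positivity)]; nlinarith
      have h1 := (abs_le.1 (Real.abs_exp_sub_one_sub_id_le hx)).2
      nlinarith [sq_nonneg ε]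
    calc Real.exp 850 ≤ Real.exp (F.card * (1700 * ε ^ 2)) := Real.exp_le_exp.2 (by nlinarith)
      _ = Real.exp (1700 * ε ^ 2) ^ F.card := Real.exp_nat_mul _ _
      _ ≤ _ := by gcongr
  -- second moment
  have hM2 : mgf S μ (2 * (100 * ε)) ≤ Real.exp 20000 := by
    rw [hSm]
    have h1 : Real.cosh (2 * (100 * ε)) - 8 * ε * Real.sinh (2 * (100 * ε))
        ≤ Real.exp (20000 * ε ^ 2) := by
      have := Real.cosh_le_exp_half_sq (2 * (100 * ε))
      have h2 : 0 ≤ Real.sinh (2 * (100 * ε)) := Real.sinh_nonneg_iff.2 (by positivity)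
      have h3 : (2 * (100 * ε)) ^ 2 / 2 = 20000 * ε ^ 2 := by ring
      rw [h3] at this
      nlinarith
    have h0' : 0 ≤ Real.cosh (2 * (100 * ε)) - 8 * ε * Real.sinh (2 * (100 * ε)) := by
      rw [← hmgf _ 0]; exact mgf_nonneg
    calc _ ≤ Real.exp (20000 * ε ^ 2) ^ F.card := by gcongr
      _ = Real.exp (F.card * (20000 * ε ^ 2)) := (Real.exp_nat_mul _ _).symm
      _ ≤ _ := Real.exp_le_exp.2 (by nlinarith)
  have hset : MeasurableSet {ω | 7 / ε ≤ S ω} := measurableSet_le measurable_const hSmeas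
  have hgoal : {ω | 7 / ε ≤ ∑ t ∈ F, (2 * B t ω - 1)} = {ω | 7 / ε ≤ S ω} := by
    ext ω; simp [hS, hY]
  rw [hgoal]
  set M := Real.exp 20000 with hM
  have hMpos : 0 < M := Real.exp_pos _
  set η := 1 / (2 * M) with hη
  have hηpos : 0 < η := by positivity
  have hpt : ∀ ω, 2 * η * Real.exp ((100 * ε) * S ω) - η ^ 2 * Real.exp ((2 * (100 * ε)) * S ω)
      - 2 * η * Real.exp 700 ≤ Set.indicator {ω | 7 / ε ≤ S ω} (fun _ => (1 : ℝ)) ω := by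
    intro ω
    have h2 : Real.exp ((2 * (100 * ε)) * S ω) = Real.exp ((100 * ε) * S ω) ^ 2 := by
      rw [← Real.exp_nat_mul]; congr 1; push_cast; ring
    rw [h2]
    set w := Real.exp ((100 * ε) * S ω)
    by_cases h : 7 / ε ≤ S ω
    · rw [Set.indicator_of_mem (by exact h)]
      have : 0 < Real.exp 700 := Real.exp_pos _
      nlinarith [sq_nonneg (η * w - 1), mul_pos hηpos this]
    · rw [Set.indicator_of_notMem (by exact h)]
      have hw : w ≤ Real.exp 700 := by
        apply Real.exp_le_exp.2
        push Not at h
        rw [lt_div_iff₀ h0] at h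
        nlinarith
      nlinarith [sq_nonneg (η * w), mul_le_mul_of_nonneg_left hw hηpos.le]
  have hint := integral_mono (μ := μ)
    ((((hEi (100 * ε)).const_mul (2 * η)).sub ((hEi (2 * (100 * ε))).const_mul (η ^ 2))).sub
      (integrable_const (2 * η * Real.exp 700)))
    ((integrable_const (1:ℝ)).indicator hset) hpt
  rw [integral_indicator_const _ hset] at hint
  simp only [Pi.sub_apply] at hint
  have hsub : Integrable (fun ω => 2 * η * Real.exp (100 * ε * S ω) -
      η ^ 2 * Real.exp (2 * (100 * ε) * S ω)) μ :=
    ((hEi (100 * ε)).const_mul (2 * η)).sub ((hEi (2 * (100 * ε))).const_mul (η ^ 2))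
  rw [integral_sub hsub (integrable_const _),
    integral_sub ((hEi (100 * ε)).const_mul (2 * η)) ((hEi (2 * (100 * ε))).const_mul (η ^ 2)),
    integral_const_mul, integral_const_mul] at hint
  change 2 * η * mgf S μ (100 * ε) - η ^ 2 * mgf S μ (2 * (100 * ε)) - _ ≤ _ at hint
  simp only [integral_const, probReal_univ, smul_eq_mul, mul_one, one_mul] at hint
  have he : 2 * Real.exp 700 ≤ mgf S μ (100 * ε) := by
    refine le_trans ?_ hM1
    have : Real.exp 850 = Real.exp 150 * Real.exp 700 := by rw [← Real.exp_add]; norm_num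
    rw [this]
    have : (2:ℝ) ≤ Real.exp 150 := by linarith [Real.add_one_le_exp (150:ℝ)]
    have := Real.exp_pos 700
    gcongr
  have h1 : 1 ≤ mgf S μ (100 * ε) := by linarith [Real.add_one_le_exp (850:ℝ)]
  have h3 : η ^ 2 * mgf S μ (2 * (100 * ε)) ≤ η ^ 2 * M := by gcongr
  have h4 : η ^ 2 * M = η / 2 := by rw [hη]; field_simp
  have h5 : Real.exp (-20000) / 4 = η / 2 := by rw [Real.exp_neg, hη, hM]; field_simp; norm_num
  rw [h5]
  nlinarith [mul_le_mul_of_nonneg_left he hηpos.le, mul_le_mul_of_nonneg_left h1 hηpos.le]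

end Aux
section Path

/-- number of indices in `F` at which the sequence `x` equals `a`. -/
def cN (a : ℝ) (x : ℕ → ℝ) (F : Finset ℕ) : ℕ := ∑ t ∈ F, if x t = a then 1 else 0

/-- closed form of the offline value. -/
def Phi (a₁ a₂ a₃ : ℝ) (z1 z12 s K : ℕ) : ℝ :=
  (a₁ - a₂) * (min z1 K : ℕ) + (a₂ - a₃) * (min z12 K : ℕ) + a₃ * (min s K : ℕ)

/-- pathwise offline value. -/
def offV (a : ℕ → ℝ) (X : ℕ → Ω → ℝ) (k n : ℕ) (ω : Ω) : ℝ :=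
  ∑ j ∈ Icc 1 3, a j * Soff a X k n j ω

lemma Zc_eq (X : ℕ → Ω → ℝ) (a : ℝ) (r : ℕ) (ω : Ω) :
    Zc X a r ω = (cN a (fun t => X t ω) (range r) : ℝ) := by
  simp [Zc, cN]

lemma offV_eq (a : ℕ → ℝ) (X : ℕ → Ω → ℝ) (k n : ℕ) (ω : Ω) :
    offV a X k n ω = Phi (a 1) (a 2) (a 3) (cN (a 1) (fun t => X t ω) (range n))
      (cN (a 1) (fun t => X t ω) (range n) + cN (a 2) (fun t => X t ω) (range n))
      (cN (a 1) (fun t => X t ω) (range n) + cN (a 2) (fun t => X t ω) (range n)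
        + cN (a 3) (fun t => X t ω) (range n)) k := by
  have hI : Icc 1 3 = ({1, 2, 3} : Finset ℕ) := by decide
  have hI2 : Icc 1 2 = ({1, 2} : Finset ℕ) := by decide
  simp only [offV, Soff, Zc_eq, Phi, hI]
  simp [hI2]
  generalize cN (a 1) (fun t => X t ω) (range n) = z1
  generalize cN (a 2) (fun t => X t ω) (range n) = z2
  generalize cN (a 3) (fun t => X t ω) (range n) = z3
  have h1 : (0:ℝ) ≤ z1 := by positivity
  have h2 : (0:ℝ) ≤ z2 := by positivity
  have h3 : (0:ℝ) ≤ z3 := by positivity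
  have h4 : (0:ℝ) ≤ k := by positivity
  rcases le_total (k:ℝ) z1 with h | h
  · rw [min_eq_right h, max_eq_right (by linarith), max_eq_right (by linarith),
      min_eq_right h2, min_eq_right h3, min_eq_right (by linarith), min_eq_right (by linarith)]
    ring
  · rw [min_eq_left h, max_eq_left (by linarith : (0:ℝ) ≤ k - z1)]
    rcases le_total (k:ℝ) (z1 + z2) with h' | h'
    · rw [max_eq_right (by linarith), min_eq_right (by linarith : (k:ℝ) - z1 ≤ z2),
        min_eq_right h3, min_eq_right h', min_eq_right (by linarith)]
      ring
    · rw [max_eq_left (by linarith), min_eq_left (by linarith : (z2:ℝ) ≤ k - z1), min_eq_left h']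
      rcases le_total (k:ℝ) (z1 + z2 + z3) with h'' | h''
      · rw [min_eq_right (by linarith), min_eq_right h'']
        ring
      · rw [min_eq_left (by linarith), min_eq_left h'']
        ring

variable {a₁ a₂ a₃ : ℝ}

lemma cN_total (h32 : a₃ < a₂) (h21 : a₂ < a₁) {x : ℕ → ℝ}
    (hx : ∀ t, x t = a₁ ∨ x t = a₂ ∨ x t = a₃) (F : Finset ℕ) :
    cN a₁ x F + cN a₂ x F + cN a₃ x F = F.card := by
  simp only [cN, ← Finset.sum_add_distrib]
  rw [Finset.card_eq_sum_ones]
  refine Finset.sum_congr rfl fun t _ => ?_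
  rcases hx t with h | h | h
  · simp [h, h21.ne', (h32.trans h21).ne']
  · simp [h, h21.ne, h32.ne']
  · simp [h, h32.ne, (h32.trans h21).ne]

lemma path_lower (h3 : 0 < a₃) (h32 : a₃ < a₂) (h21 : a₂ < a₁) {x : ℕ → ℝ}
    (hx : ∀ t, x t = a₁ ∨ x t = a₂ ∨ x t = a₃) {s : ℕ → ℕ} {n k h : ℕ} (hs1 : ∀ t, s t ≤ 1)
    (hsk : ∑ t ∈ range n, s t ≤ k) (hh : h ≤ n) :
    ∑ t ∈ range n, x t * (s t : ℝ)
      + (a₁ - a₂) * (∑ t ∈ range h, (s t : ℝ) * (if x t = a₂ then 1 else 0)) *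
        (if k ≤ cN a₁ x (range n) then 1 else 0)
      + (a₂ - a₃) * (∑ t ∈ range h, (1 - (s t : ℝ)) * (if x t = a₂ then 1 else 0)) *
        (if cN a₁ x (range n) + cN a₂ x (range n) ≤ k then 1 else 0)
      ≤ Phi a₁ a₂ a₃ (cN a₁ x (range n)) (cN a₁ x (range n) + cN a₂ x (range n))
        (cN a₁ x (range n) + cN a₂ x (range n) + cN a₃ x (range n)) k := by
  set S : ℝ → ℕ := fun a => ∑ t ∈ range n, s t * (if x t = a then 1 else 0) with hS
  have hSZ : ∀ a, S a ≤ cN a x (range n) := fun a => Finset.sum_le_sum fun t _ => by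
    have := hs1 t
    split_ifs <;> simp [this]
  have hsum : S a₁ + S a₂ + S a₃ = ∑ t ∈ range n, s t := by
    simp only [hS, ← Finset.sum_add_distrib]
    refine Finset.sum_congr rfl fun t _ => ?_
    rcases hx t with h | h | h
    · simp [h, h21.ne', (h32.trans h21).ne']
    · simp [h, h21.ne, h32.ne']
    · simp [h, h32.ne, (h32.trans h21).ne]
  have hval : ∑ t ∈ range n, x t * (s t : ℝ) = a₁ * S a₁ + a₂ * S a₂ + a₃ * S a₃ := by
    simp only [hS, Nat.cast_sum, Finset.mul_sum, ← Finset.sum_add_distrib]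
    refine Finset.sum_congr rfl fun t _ => ?_
    rcases hx t with h | h | h
    · simp [h, h21.ne', (h32.trans h21).ne']
    · simp [h, h21.ne, h32.ne']
    · simp [h, h32.ne, (h32.trans h21).ne]
  set T : ℕ := ∑ t ∈ range h, s t * (if x t = a₂ then 1 else 0) with hT
  set D : ℕ := ∑ t ∈ range h, (1 - s t) * (if x t = a₂ then 1 else 0) with hD
  have hTr : (∑ t ∈ range h, (s t : ℝ) * (if x t = a₂ then 1 else 0)) = T := by simp [hT]
  have hDr : (∑ t ∈ range h, (1 - (s t : ℝ)) * (if x t = a₂ then 1 else 0)) = D := by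
    simp only [hD, Nat.cast_sum, Nat.cast_mul]
    refine Finset.sum_congr rfl fun t _ => ?_
    rw [Nat.cast_sub (hs1 t)]
    simp
  have hTS : T ≤ S a₂ :=
    Finset.sum_le_sum_of_subset (Finset.range_subset_range.2 hh)
  have hDS : D + S a₂ ≤ cN a₂ x (range n) := by
    have h1 : D ≤ ∑ t ∈ range n, (1 - s t) * (if x t = a₂ then 1 else 0) :=
      Finset.sum_le_sum_of_subset (Finset.range_subset_range.2 hh)
    refine (Nat.add_le_add_right h1 _).trans ?_
    simp only [hS, cN, ← Finset.sum_add_distrib]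
    refine Finset.sum_le_sum fun t _ => ?_
    have := hs1 t
    split_ifs <;> omega
  rw [hTr, hDr, hval]
  have z1 := hSZ a₁
  have z2 := hSZ a₂
  have z3 := hSZ a₃
  have e1 : S a₁ + T * (if k ≤ cN a₁ x (range n) then 1 else 0) ≤ min (cN a₁ x (range n)) k := by
    split_ifs <;> omega
  have e2 : S a₁ + S a₂ + D * (if cN a₁ x (range n) + cN a₂ x (range n) ≤ k then 1 else 0)
      ≤ min (cN a₁ x (range n) + cN a₂ x (range n)) k := by
    split_ifs <;> omega
  have e3 : S a₁ + S a₂ + S a₃ ≤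
      min (cN a₁ x (range n) + cN a₂ x (range n) + cN a₃ x (range n)) k := by omega
  have e1' := (Nat.cast_le (α := ℝ)).2 e1
  have e2' := (Nat.cast_le (α := ℝ)).2 e2
  have e3' := (Nat.cast_le (α := ℝ)).2 e3
  push_cast at e1' e2' e3'
  simp only [Phi]
  push_cast
  have := mul_le_mul_of_nonneg_left e1' (sub_nonneg.2 h21.le)
  have := mul_le_mul_of_nonneg_left e2' (sub_nonneg.2 h32.le)
  have := mul_le_mul_of_nonneg_left e3' h3.le
  nlinarith

/-- one decision of the policy used for bounded regret. -/
def dec (a₁ a₂ a₃ θ : ℝ) (n t K : ℕ) (x : ℝ) : ℕ :=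
  if 1 ≤ K ∧ (x = a₁ ∨ (x = a₂ ∧ θ * ((n - t - 1 : ℕ) : ℝ) + 1 ≤ K) ∨ (x = a₃ ∧ n - t ≤ K))
  then 1 else 0

/-- remaining budget of that policy. -/
def Kp (a₁ a₂ a₃ θ : ℝ) (n k : ℕ) (x : ℕ → ℝ) : ℕ → ℕ
  | 0 => k
  | t + 1 => Kp a₁ a₂ a₃ θ n k x t - dec a₁ a₂ a₃ θ n t (Kp a₁ a₂ a₃ θ n k x t) (x t)

lemma dec_le_one (θ : ℝ) (n t K : ℕ) (x : ℝ) : dec a₁ a₂ a₃ θ n t K x ≤ 1 := by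
  unfold dec; split_ifs <;> simp

lemma dec_le (θ : ℝ) (n t K : ℕ) (x : ℝ) : dec a₁ a₂ a₃ θ n t K x ≤ K := by
  unfold dec; split_ifs with h
  · exact h.1
  · simp

lemma Kp_sum (θ : ℝ) (n k : ℕ) (x : ℕ → ℝ) (m : ℕ) :
    ∑ t ∈ range m, dec a₁ a₂ a₃ θ n t (Kp a₁ a₂ a₃ θ n k x t) (x t)
      + Kp a₁ a₂ a₃ θ n k x m = k := by
  induction m with
  | zero => simp [Kp]
  | succ m ih =>
    rw [Finset.sum_range_succ]
    have := dec_le (a₁ := a₁) (a₂ := a₂) (a₃ := a₃) θ n m (Kp a₁ a₂ a₃ θ n k x m) (x m)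
    simp only [Kp]
    omega

lemma step_upper (h3 : 0 < a₃) (h32 : a₃ < a₂) (h21 : a₂ < a₁) (θ : ℝ) {n t K z1 z2 s : ℕ}
    (hs : n - t = s + 1) (hz : z1 + z2 ≤ s) {x : ℝ} (hx : x = a₁ ∨ x = a₂ ∨ x = a₃) :
    Phi a₁ a₂ a₃ ((if x = a₁ then 1 else 0) + z1)
      (((if x = a₁ then 1 else 0) + z1) + ((if x = a₂ then 1 else 0) + z2)) (s + 1) K
      ≤ x * (dec a₁ a₂ a₃ θ n t K x : ℝ)
        + Phi a₁ a₂ a₃ z1 (z1 + z2) s (K - dec a₁ a₂ a₃ θ n t K x)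
        + a₁ * (if θ * s < z1 ∨ ((z1 + z2 : ℕ) : ℝ) < θ * s then 1 else 0) := by
  have h31 := h32.trans h21
  have hs' : n - t - 1 = s := by omega
  have hbad : 0 ≤ a₁ * (if θ * s < z1 ∨ ((z1 + z2 : ℕ) : ℝ) < θ * s then (1:ℝ) else 0) := by
    split_ifs <;> simp; linarith
  rcases hx with rfl | rfl | rfl
  · -- ability one
    rcases Nat.eq_zero_or_pos K with rfl | hK
    · simp only [Phi, dec, Nat.zero_sub, Nat.min_zero]; push_cast at hbad ⊢; simpa using hbad
    · have hd : dec x a₂ a₃ θ n t K x = 1 := by simp [dec]; omega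
      rw [hd]
      simp only [Phi, h21.ne', if_true, if_false]
      have e1 : min (1 + z1) K = min z1 (K - 1) + 1 := by omega
      have e2 : min (1 + z1 + (0 + z2)) K = min (z1 + z2) (K - 1) + 1 := by omega
      have e3 : min (s + 1) K = min s (K - 1) + 1 := by omega
      rw [e1, e2, e3]
      push_cast at hbad ⊢
      linarith
  · -- ability two
    by_cases hd : 1 ≤ K ∧ θ * (s : ℝ) + 1 ≤ K
    · have hd1 : dec a₁ x a₃ θ n t K x = 1 := by
        simp only [dec, hs']; rw [if_pos]; exact ⟨hd.1, Or.inr (Or.inl ⟨by trivial, hd.2⟩)⟩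
      rw [hd1]
      simp only [Phi, h21.ne, if_true, if_false]
      have e2 : min (0 + z1 + (1 + z2)) K = min (z1 + z2) (K - 1) + 1 := by omega
      have e3 : min (s + 1) K = min s (K - 1) + 1 := by omega
      rw [e2, e3]
      by_cases hb : θ * s < z1
      · rw [if_pos (Or.inl hb)]
        have e1 : min (0 + z1) K ≤ min z1 (K - 1) + 1 := by omega
        have e1' := (Nat.cast_le (α := ℝ)).2 e1
        have := mul_le_mul_of_nonneg_left e1' (sub_nonneg.2 h21.le)
        push_cast at this ⊢
        nlinarith
      · have hz1 : z1 + 1 ≤ K := by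
          push Not at hb
          have : (z1 : ℝ) + 1 ≤ K := by linarith [hd.2]
          exact_mod_cast this
        have e1 : min (0 + z1) K = min z1 (K - 1) := by omega
        rw [e1]
        push_cast at hbad ⊢
        linarith
    · have hd1 : dec a₁ x a₃ θ n t K x = 0 := by
        simp only [dec, hs']; rw [if_neg]
        rintro ⟨h1, h2 | h2 | h2⟩
        · exact h21.ne h2
        · exact hd ⟨h1, h2.2⟩
        · exact h32.ne' h2.1
      rw [hd1]
      simp only [Phi, h21.ne, if_true, if_false]
      by_cases hb : ((z1 + z2 : ℕ) : ℝ) < θ * s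
      · rw [if_pos (Or.inr hb)]
        have e1 : min (0 + z1) K = min z1 (K - 0) := by omega
        have e2 : min (0 + z1 + (1 + z2)) K ≤ min (z1 + z2) (K - 0) + 1 := by omega
        have e3 : min (s + 1) K ≤ min s (K - 0) + 1 := by omega
        rw [e1]
        have e2' := mul_le_mul_of_nonneg_left ((Nat.cast_le (α := ℝ)).2 e2) (sub_nonneg.2 h32.le)
        have e3' := mul_le_mul_of_nonneg_left ((Nat.cast_le (α := ℝ)).2 e3) h3.le
        push_cast at e2' e3' ⊢
        nlinarith
      · have hz1 : K ≤ z1 + z2 := by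
          rcases Nat.eq_zero_or_pos K with rfl | hK
          · simp
          · push Not at hb
            have h1 : (K : ℝ) < θ * s + 1 := by
              by_contra hc
              exact hd ⟨hK, not_lt.1 hc⟩
            have : (K : ℝ) < ((z1 + z2 : ℕ) : ℝ) + 1 := by linarith
            have : K < z1 + z2 + 1 := by exact_mod_cast this
            omega
        have e1 : min (0 + z1) K = min z1 (K - 0) := by omega
        have e2 : min (0 + z1 + (1 + z2)) K = min (z1 + z2) (K - 0) := by omega
        have e3 : min (s + 1) K = min s (K - 0) := by omega
        rw [e1, e2, e3]
        push_cast at hbad ⊢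
        linarith
  · -- ability three
    by_cases hd : s + 1 ≤ K
    · have hd1 : dec a₁ a₂ x θ n t K x = 1 := by
        simp only [dec, hs]; rw [if_pos]; exact ⟨by omega, Or.inr (Or.inr ⟨by trivial, hd⟩)⟩
      rw [hd1]
      simp only [Phi, h31.ne, h32.ne, if_false]
      have e1 : min (0 + z1) K = min z1 (K - 1) := by omega
      have e2 : min (0 + z1 + (0 + z2)) K = min (z1 + z2) (K - 1) := by omega
      have e3 : min (s + 1) K = min s (K - 1) + 1 := by omega
      rw [e1, e2, e3]
      push_cast at hbad ⊢
      linarith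
    · have hd1 : dec a₁ a₂ x θ n t K x = 0 := by
        simp only [dec, hs]; rw [if_neg]
        rintro ⟨h1, h2 | h2 | h2⟩
        · exact h31.ne h2
        · exact h32.ne h2.1
        · exact hd h2.2
      rw [hd1]
      simp only [Phi, h31.ne, h32.ne, if_false]
      have e1 : min (0 + z1) K = min z1 (K - 0) := by omega
      have e2 : min (0 + z1 + (0 + z2)) K = min (z1 + z2) (K - 0) := by omega
      have e3 : min (s + 1) K = min s (K - 0) := by omega
      rw [e1, e2, e3]
      push_cast at hbad ⊢
      linarith

/-- the bad event at time `t`. -/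
def bad (a₁ a₂ θ : ℝ) (n : ℕ) (x : ℕ → ℝ) (t : ℕ) : Prop :=
  θ * ((n - t - 1 : ℕ) : ℝ) < cN a₁ x (Ico (t + 1) n) ∨
    ((cN a₁ x (Ico (t + 1) n) + cN a₂ x (Ico (t + 1) n) : ℕ) : ℝ) < θ * ((n - t - 1 : ℕ) : ℝ)

open Classical in
lemma path_upper (h3 : 0 < a₃) (h32 : a₃ < a₂) (h21 : a₂ < a₁) (θ : ℝ) {x : ℕ → ℝ}
    (hx : ∀ t, x t = a₁ ∨ x t = a₂ ∨ x t = a₃) (n k : ℕ) :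
    Phi a₁ a₂ a₃ (cN a₁ x (range n)) (cN a₁ x (range n) + cN a₂ x (range n))
        (cN a₁ x (range n) + cN a₂ x (range n) + cN a₃ x (range n)) k
      ≤ ∑ t ∈ range n, x t * (dec a₁ a₂ a₃ θ n t (Kp a₁ a₂ a₃ θ n k x t) (x t) : ℝ)
        + a₁ * ∑ t ∈ range n, (if bad a₁ a₂ θ n x t then 1 else 0) := by
  have key : ∀ m ≤ n,
      Phi a₁ a₂ a₃ (cN a₁ x (Ico 0 n)) (cN a₁ x (Ico 0 n) + cN a₂ x (Ico 0 n)) n k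
      ≤ ∑ t ∈ range m, x t * (dec a₁ a₂ a₃ θ n t (Kp a₁ a₂ a₃ θ n k x t) (x t) : ℝ)
        + a₁ * ∑ t ∈ range m, (if bad a₁ a₂ θ n x t then 1 else 0)
        + Phi a₁ a₂ a₃ (cN a₁ x (Ico m n)) (cN a₁ x (Ico m n) + cN a₂ x (Ico m n)) (n - m)
          (Kp a₁ a₂ a₃ θ n k x m) := by
    intro m
    induction m with
    | zero => intro _; simp [Kp]
    | succ m ih =>
      intro hm
      have ih' := ih (by omega)
      refine ih'.trans ?_
      have hc : ∀ a, cN a x (Ico m n) = (if x m = a then 1 else 0) + cN a x (Ico (m + 1) n) := by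
        intro a
        simp only [cN]
        rw [Finset.sum_eq_sum_Ico_succ_bot (by omega)]
      have htot := cN_total h32 h21 hx (Ico (m + 1) n)
      rw [Nat.card_Ico] at htot
      have hst := step_upper h3 h32 h21 θ (n := n) (t := m) (K := Kp a₁ a₂ a₃ θ n k x m)
        (z1 := cN a₁ x (Ico (m + 1) n)) (z2 := cN a₂ x (Ico (m + 1) n)) (s := n - (m + 1))
        (by omega) (by omega) (hx m)
      rw [hc a₁, hc a₂, Finset.sum_range_succ, Finset.sum_range_succ]
      have e : n - m = n - (m + 1) + 1 := by omega
      rw [e]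
      have hb : (if bad a₁ a₂ θ n x m then (1:ℝ) else 0) =
        if θ * ((n - (m + 1) : ℕ) : ℝ) < cN a₁ x (Ico (m + 1) n) ∨
          ((cN a₁ x (Ico (m + 1) n) + cN a₂ x (Ico (m + 1) n) : ℕ) : ℝ)
            < θ * ((n - (m + 1) : ℕ) : ℝ) then 1 else 0 := by
        have e' : n - (m + 1) = n - m - 1 := by omega
        rw [e']
        unfold bad
        congr
      rw [hb]
      simp only [Kp]
      rw [mul_add]
      linarith
  have := key n le_rfl
  rw [cN_total h32 h21 hx, Finset.card_range, Finset.range_eq_Ico]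
  rw [Finset.range_eq_Ico] at this
  simpa [Phi, cN] using this

end Path
section Prob

/-- bundled hypotheses. -/
structure Hyp [MeasurableSpace Ω] (μ : Measure Ω) (a₁ a₂ a₃ ε : ℝ) (X U : ℕ → Ω → ℝ) : Prop where
  h0 : 0 < ε
  h8 : ε < 1 / 8
  h3 : 0 < a₃
  h32 : a₃ < a₂
  h21 : a₂ < a₁
  mX : ∀ t, Measurable (X t)
  mU : ∀ t, Measurable (U t)
  d1 : ∀ t, μ {ω | X t ω = a₁} = ENNReal.ofReal (1 / 2 - 4 * ε)
  d2 : ∀ t, μ {ω | X t ω = a₂} = ENNReal.ofReal (2 * ε)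
  d3 : ∀ t, μ {ω | X t ω = a₃} = ENNReal.ofReal (1 / 2 + 2 * ε)
  ind : iIndepFun (fun t ω => (X t ω, U t ω)) μ

lemma cN_meas {m : MeasurableSpace Ω} {X : ℕ → Ω → ℝ} {F : Finset ℕ} (a : ℝ)
    (hX : ∀ t ∈ F, Measurable[m] (X t)) :
    Measurable[m] (fun ω => cN a (fun t => X t ω) F) := by
  unfold cN
  refine Finset.measurable_sum F fun t ht => ?_
  exact Measurable.ite (hX t ht (measurableSet_singleton a)) measurable_const measurable_const

lemma cN_le (a : ℝ) (x : ℕ → ℝ) (F : Finset ℕ) : cN a x F ≤ F.card := by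
  unfold cN
  rw [Finset.card_eq_sum_ones]
  refine Finset.sum_le_sum fun t _ => ?_
  split_ifs <;> simp

lemma meas_Fil {X U : ℕ → Ω → ℝ} {s t : ℕ} (h : s < t) :
    Measurable[Fil X U t] (fun ω => (X s ω, U s ω)) := by
  have h1 : Measurable[Fil X U t] (fun ω => fun s : Fin t => (X s ω, U s ω)) :=
    comap_measurable _
  exact (measurable_pi_apply (⟨s, h⟩ : Fin t)).comp h1

lemma measX_Fil {X U : ℕ → Ω → ℝ} {s t : ℕ} (h : s < t) : Measurable[Fil X U t] (X s) :=
  measurable_fst.comp (meas_Fil (U := U) h)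

lemma Fil_le {X U : ℕ → Ω → ℝ} {t : ℕ} {m : MeasurableSpace Ω}
    (h : ∀ s < t, Measurable[m] (fun ω => (X s ω, U s ω))) : Fil X U t ≤ m := by
  have : Measurable[m] (fun ω => fun s : Fin t => (X s ω, U s ω)) :=
    measurable_pi_lambda _ fun s => h s s.2
  exact this.comap_le

lemma Fil_mono {X U : ℕ → Ω → ℝ} {s t : ℕ} (h : s ≤ t) : Fil X U s ≤ Fil X U t :=
  Fil_le fun _ hr => meas_Fil (hr.trans_le h)

/-- The policy with bounded regret. -/
def polB (a₁ a₂ a₃ θ : ℝ) (X : ℕ → Ω → ℝ) (n k t : ℕ) (ω : Ω) : ℕ :=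
  dec a₁ a₂ a₃ θ n t (Kp a₁ a₂ a₃ θ n k (fun t => X t ω) t) (X t ω)

lemma dec_meas {a₁ a₂ a₃ : ℝ} {m : MeasurableSpace Ω} (θ : ℝ) (n t : ℕ) {K : Ω → ℕ} {Y : Ω → ℝ}
    (hK : Measurable[m] K) (hY : Measurable[m] Y) :
    Measurable[m] (fun ω => dec a₁ a₂ a₃ θ n t (K ω) (Y ω)) := by
  unfold dec
  refine Measurable.ite ?_ measurable_const measurable_const
  have hKs : ∀ p : ℕ → Prop, MeasurableSet {ω | p (K ω)} := fun p =>
    hK (MeasurableSet.of_discrete (s := {j | p j}))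
  have hYs : ∀ a : ℝ, MeasurableSet {ω | Y ω = a} := fun a => hY (measurableSet_singleton a)
  exact (hKs (fun K => 1 ≤ K)).inter ((hYs a₁).union (((hYs a₂).inter
    (hKs fun K => θ * ((n - t - 1 : ℕ) : ℝ) + 1 ≤ K)).union
    ((hYs a₃).inter (hKs fun K => n - t ≤ K))))

lemma Kp_meas {a₁ a₂ a₃ : ℝ} {X U : ℕ → Ω → ℝ} (θ : ℝ) (n k t : ℕ) :
    Measurable[Fil X U t] (fun ω => Kp a₁ a₂ a₃ θ n k (fun t => X t ω) t) := by
  induction t with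
  | zero => exact measurable_const
  | succ t ih =>
    have h1 := ih.mono (Fil_mono (X := X) (U := U) (Nat.le_succ t)) le_rfl
    have h2 := dec_meas (a₁ := a₁) (a₂ := a₂) (a₃ := a₃) θ n t h1
      (measX_Fil (X := X) (U := U) (Nat.lt_succ_self t))
    exact (measurable_from_prod_countable_right (f := fun p : ℕ × ℕ => p.1 - p.2)
      fun _ => measurable_from_nat).comp (h1.prodMk h2)

lemma polB_policy {a₁ a₂ a₃ : ℝ} {X U : ℕ → Ω → ℝ} (θ : ℝ) (n k : ℕ) : IsPolicy X U n k (polB a₁ a₂ a₃ θ X n k) := by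
  refine ⟨fun t ω => dec_le_one _ _ _ _ _, fun t => ?_, fun ω => ?_⟩
  · have h1 := (Kp_meas (a₁ := a₁) (a₂ := a₂) (a₃ := a₃) (X := X) (U := U) θ n k t).mono
      (Fil_mono (X := X) (U := U) (Nat.le_succ t)) le_rfl
    exact dec_meas θ n t h1 (measX_Fil (X := X) (U := U) (Nat.lt_succ_self t))
  · have := Kp_sum (a₁ := a₁) (a₂ := a₂) (a₃ := a₃) θ n k (fun t => X t ω) n
    unfold polB
    omega

variable [MeasurableSpace Ω] {μ : Measure Ω} [IsProbabilityMeasure μ] {a₁ a₂ a₃ ε : ℝ}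
  {X U : ℕ → Ω → ℝ}

lemma Hyp.Fil_le' (H : Hyp μ a₁ a₂ a₃ ε X U) (t : ℕ) : Fil X U t ≤ ‹MeasurableSpace Ω› :=
  Fil_le fun s _ => (H.mX s).prodMk (H.mU s)

lemma Hyp.indep (H : Hyp μ a₁ a₂ a₃ ε X U) {φ : ℝ → ℝ} (hφ : Measurable φ) :
    iIndepFun (fun t ω => φ (X t ω)) μ :=
  H.ind.comp (fun _ p => φ p.1) fun _ => hφ.comp measurable_fst

lemma meas_ind (a : ℝ) : Measurable (fun x : ℝ => if x = a then (1:ℝ) else 0) :=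
  Measurable.ite (measurableSet_singleton a) measurable_const measurable_const

lemma Hyp.mset (H : Hyp μ a₁ a₂ a₃ ε X U) (a : ℝ) (t : ℕ) : MeasurableSet {ω | X t ω = a} :=
  H.mX t (measurableSet_singleton a)

lemma Hyp.integral_ind (H : Hyp μ a₁ a₂ a₃ ε X U) (a : ℝ) (t : ℕ) :
    ∫ ω, (if X t ω = a then (1:ℝ) else 0) ∂μ = μ.real {ω | X t ω = a} := by
  have : (fun ω => if X t ω = a then (1:ℝ) else 0) = Set.indicator {ω | X t ω = a} 1 := by
    ext ω; simp [Set.indicator_apply]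
  rw [this, integral_indicator_one (H.mset a t)]

lemma Hyp.i1 (H : Hyp μ a₁ a₂ a₃ ε X U) (t : ℕ) :
    ∫ ω, (if X t ω = a₁ then (1:ℝ) else 0) ∂μ = 1 / 2 - 4 * ε := by
  rw [H.integral_ind, Measure.real, H.d1, ENNReal.toReal_ofReal (by linarith [H.h8])]

lemma Hyp.i2 (H : Hyp μ a₁ a₂ a₃ ε X U) (t : ℕ) :
    ∫ ω, (if X t ω = a₂ then (1:ℝ) else 0) ∂μ = 2 * ε := by
  rw [H.integral_ind, Measure.real, H.d2, ENNReal.toReal_ofReal (by linarith [H.h0])]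

lemma Hyp.integrable_ind (H : Hyp μ a₁ a₂ a₃ ε X U) (a : ℝ) (t : ℕ) :
    Integrable (fun ω => if X t ω = a then (1:ℝ) else 0) μ :=
  Integrable.of_bound ((meas_ind a).comp (H.mX t)).aestronglyMeasurable 1
    (Filter.Eventually.of_forall fun ω => by split_ifs <;> simp)

lemma Hyp.i12 (H : Hyp μ a₁ a₂ a₃ ε X U) (t : ℕ) :
    ∫ ω, ((if X t ω = a₁ then (1:ℝ) else 0) + (if X t ω = a₂ then (1:ℝ) else 0)) ∂μ
      = 1 / 2 - 2 * ε := by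
  rw [integral_add (H.integrable_ind _ _) (H.integrable_ind _ _), H.i1, H.i2]
  ring

lemma Hyp.ae_val (H : Hyp μ a₁ a₂ a₃ ε X U) :
    ∀ᵐ ω ∂μ, ∀ t, X t ω = a₁ ∨ X t ω = a₂ ∨ X t ω = a₃ := by
  rw [ae_all_iff]
  intro t
  have h32 := H.h32
  have h21 := H.h21
  have h0 := H.h0
  have h8 := H.h8
  have hd1 : Disjoint {ω | X t ω = a₂} {ω | X t ω = a₃} := by
    rw [Set.disjoint_left]; intro ω h1 h2
    simp only [Set.mem_ofPred_eq] at h1 h2; linarith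
  have hd2 : Disjoint {ω | X t ω = a₁} ({ω | X t ω = a₂} ∪ {ω | X t ω = a₃}) := by
    rw [Set.disjoint_left]; intro ω h1 h2
    rcases h2 with h2 | h2 <;> simp only [Set.mem_ofPred_eq] at h1 h2 <;> linarith
  have hm := (H.mset a₁ t).union ((H.mset a₂ t).union (H.mset a₃ t))
  have : μ ({ω | X t ω = a₁} ∪ ({ω | X t ω = a₂} ∪ {ω | X t ω = a₃})) = 1 := by
    rw [measure_union hd2 ((H.mset a₂ t).union (H.mset a₃ t)), measure_union hd1 (H.mset a₃ t),
      H.d1, H.d2, H.d3, ← ENNReal.ofReal_add (by linarith) (by linarith),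
      ← ENNReal.ofReal_add (by linarith) (by linarith), ← ENNReal.ofReal_one]
    congr 1
    ring
  have h := (prob_compl_eq_zero_iff hm).2 this
  rw [ae_iff]
  convert h using 2
  ext ω
  simp

lemma Hyp.offV_meas (H : Hyp μ a₁ a₂ a₃ ε X U) (aa : ℕ → ℝ) (k n j : ℕ) :
    Measurable (Soff aa X k n j) := by
  have hZ : ∀ a, Measurable (Zc X a n) := fun a => by
    have hcast : Measurable (fun k : ℕ => (k : ℝ)) := measurable_from_nat
    have := hcast.comp
      (cN_meas (F := range n) a fun t _ => H.mX t)
    convert this using 1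
    ext ω
    exact Zc_eq X a n ω
  unfold Soff
  exact (hZ _).min ((measurable_const.sub (Finset.measurable_sum _ fun i _ => hZ _)).max
    measurable_const)

lemma Hyp.Soff_int (H : Hyp μ a₁ a₂ a₃ ε X U) (aa : ℕ → ℝ) (k n j : ℕ) :
    Integrable (Soff aa X k n j) μ := by
  refine Integrable.of_bound (H.offV_meas aa k n j).aestronglyMeasurable n
    (Filter.Eventually.of_forall fun ω => ?_)
  have h1 : 0 ≤ Zc X (aa j) n ω := by rw [Zc_eq]; positivity
  have h2 : Zc X (aa j) n ω ≤ n := by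
    rw [Zc_eq]
    have := cN_le (aa j) (fun t => X t ω) (range n)
    rw [Finset.card_range] at this
    exact_mod_cast this
  have h4 : 0 ≤ Soff aa X k n j ω := le_min h1 (le_max_right _ _)
  rw [Real.norm_eq_abs, abs_of_nonneg h4]
  exact (min_le_left _ _).trans h2

lemma Hyp.offV_int (H : Hyp μ a₁ a₂ a₃ ε X U) (aa : ℕ → ℝ) (k n : ℕ) :
    Integrable (offV aa X k n) μ :=
  integrable_finsetSum _ fun j _ => (H.Soff_int aa k n j).const_mul _

lemma Hyp.Voff_eq (H : Hyp μ a₁ a₂ a₃ ε X U) (aa : ℕ → ℝ) (k n : ℕ) :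
    Voff μ 3 aa X n k = ∫ ω, offV aa X k n ω ∂μ := by
  unfold Voff offV
  rw [integral_finsetSum _ fun j _ => (H.Soff_int aa k n j).const_mul _]
  simp only [integral_const_mul]

lemma Hyp.pol_meas (H : Hyp μ a₁ a₂ a₃ ε X U) {n k : ℕ} {σp : ℕ → Ω → ℕ}
    (hσ : IsPolicy X U n k σp) (t : ℕ) : Measurable (σp t) :=
  (hσ.2.1 t).mono (H.Fil_le' _) le_rfl

lemma Hyp.pol_int (H : Hyp μ a₁ a₂ a₃ ε X U) {n k : ℕ} {σp : ℕ → Ω → ℕ}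
    (hσ : IsPolicy X U n k σp) :
    Integrable (fun ω => ∑ t ∈ range n, X t ω * (σp t ω : ℝ)) μ := by
  refine integrable_finsetSum _ fun t _ => ?_
  refine Integrable.of_bound ((H.mX t).mul (measurable_from_nat.comp
    (H.pol_meas hσ t))).aestronglyMeasurable a₁ ?_
  filter_upwards [H.ae_val] with ω hω
  have h1 := H.h21
  have h2 := H.h32
  have h3 := H.h3
  have hx : |X t ω| ≤ a₁ := by
    rcases hω t with h | h | h <;> rw [h, abs_of_pos] <;> linarith
  have hs : |(σp t ω : ℝ)| ≤ 1 := by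
    rw [abs_of_nonneg (by positivity)]
    exact_mod_cast hσ.1 t ω
  rw [Real.norm_eq_abs]
  rw [abs_mul]
  nlinarith [abs_nonneg (X t ω), abs_nonneg (σp t ω : ℝ)]

lemma Hyp.Von_le (H : Hyp μ a₁ a₂ a₃ ε X U) {n k : ℕ} {σp : ℕ → Ω → ℕ}
    (hσ : IsPolicy X U n k σp) {aa : ℕ → ℝ} (e1 : aa 1 = a₁) (e2 : aa 2 = a₂) (e3 : aa 3 = a₃) :
    Von μ X n σp ≤ Voff μ 3 aa X n k := by
  rw [H.Voff_eq]
  refine integral_mono_ae (H.pol_int hσ) (H.offV_int aa k n) ?_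
  filter_upwards [H.ae_val] with ω hω
  rw [offV_eq, e1, e2, e3]
  have := path_lower H.h3 H.h32 H.h21 hω (fun t => hσ.1 t ω) (hσ.2.2 ω) (Nat.zero_le n)
  simpa using this

lemma Hyp.bad_prob (H : Hyp μ a₁ a₂ a₃ ε X U) (n t : ℕ) :
    MeasurableSet {ω | bad a₁ a₂ (1 / 2 - 3 * ε) n (fun t => X t ω) t} ∧
    μ.real {ω | bad a₁ a₂ (1 / 2 - 3 * ε) n (fun t => X t ω) t}
      ≤ 2 * Real.exp (-(2 * ε ^ 2)) ^ (n - t - 1) := by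
  have hc : (Ico (t + 1) n).card = n - t - 1 := by rw [Nat.card_Ico]; omega
  have hm1 := cN_meas (F := Ico (t + 1) n) a₁ fun t _ => H.mX t
  have hm2 := cN_meas (F := Ico (t + 1) n) a₂ fun t _ => H.mX t
  have hsets : {ω | bad a₁ a₂ (1 / 2 - 3 * ε) n (fun t => X t ω) t} ⊆
      {ω | ((Ico (t + 1) n).card : ℝ) * ε ≤ ∑ i ∈ Ico (t + 1) n, (if X i ω = a₁ then (1:ℝ) else 0)
        - (Ico (t + 1) n).card * (1 / 2 - 4 * ε)} ∪
      {ω | ((Ico (t + 1) n).card : ℝ) * ε ≤ ∑ i ∈ Ico (t + 1) n,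
        (1 - ((if X i ω = a₁ then (1:ℝ) else 0) + (if X i ω = a₂ then (1:ℝ) else 0)))
        - (Ico (t + 1) n).card * (1 / 2 + 2 * ε)} := by
    rintro ω (h | h)
    · left
      simp only [cN] at h
      push_cast at h
      simp only [Set.mem_ofPred_eq, hc]
      nlinarith
    · right
      simp only [cN] at h
      push_cast at h
      simp only [Set.mem_ofPred_eq, Finset.sum_sub_distrib, Finset.sum_add_distrib,
        Finset.sum_const, nsmul_eq_mul, hc]
      nlinarith
  constructor
  · have hp := hm1.prodMk hm2
    exact hp (MeasurableSet.of_discrete (s := {p : ℕ × ℕ |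
      (1 / 2 - 3 * ε) * ((n - t - 1 : ℕ) : ℝ) < (p.1 : ℝ) ∨
        ((p.1 + p.2 : ℕ) : ℝ) < (1 / 2 - 3 * ε) * ((n - t - 1 : ℕ) : ℝ)}))
  · refine (measureReal_mono hsets).trans ((measureReal_union_le _ _).trans ?_)
    have m12 : Measurable (fun x : ℝ => 1 - ((if x = a₁ then (1:ℝ) else 0) +
        (if x = a₂ then (1:ℝ) else 0))) :=
      measurable_const.sub ((meas_ind a₁).add (meas_ind a₂))
    have b1 := hoeff_aux (fun t => (meas_ind a₁).comp (H.mX t)) (H.indep (meas_ind a₁))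
      (fun t ω => by
        simp only [Function.comp]
        split_ifs <;> simp) (fun t => H.i1 t) (Ico (t + 1) n) H.h0.le
    have b2 := hoeff_aux (q := 1 / 2 + 2 * ε) (fun t => m12.comp (H.mX t)) (H.indep m12)
      (fun t ω => by
        have h21 := H.h21
        simp only [Function.comp]
        split_ifs with h1 h2 h2
        · linarith
        all_goals simp) (fun t => by
          simp only [Function.comp]
          have hadd : Integrable (fun ω => (if X t ω = a₁ then (1:ℝ) else 0) +
            (if X t ω = a₂ then (1:ℝ) else 0)) μ :=
            (H.integrable_ind _ _).add (H.integrable_ind _ _)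
          rw [integral_sub (integrable_const _) hadd, H.i12]
          simp
          ring) (Ico (t + 1) n) H.h0.le
    simp only [Function.comp] at b1 b2
    rw [hc] at b1 b2 ⊢
    linarith

lemma Hyp.bdd (H : Hyp μ a₁ a₂ a₃ ε X U) {aa : ℕ → ℝ} (e1 : aa 1 = a₁) (e2 : aa 2 = a₂)
    (e3 : aa 3 = a₃) (n k : ℕ) :
    Voff μ 3 aa X n k - VonStar μ X U n k ≤ a₁ * (2 * (1 - Real.exp (-(2 * ε ^ 2)))⁻¹) := by
  classical
  set θ := 1 / 2 - 3 * ε with hθ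
  set r := Real.exp (-(2 * ε ^ 2)) with hr
  have hr0 : 0 ≤ r := (Real.exp_pos _).le
  have hr1 : r < 1 := by
    rw [hr, Real.exp_lt_one_iff]
    have := H.h0
    have : 0 < ε ^ 2 := by positivity
    linarith
  have hpol := polB_policy (X := X) (U := U) (a₁ := a₁) (a₂ := a₂) (a₃ := a₃) θ n k
  have hle : Von μ X n (polB a₁ a₂ a₃ θ X n k) ≤ VonStar μ X U n k := by
    refine le_csSup ⟨Voff μ 3 aa X n k, ?_⟩ ⟨_, hpol, rfl⟩
    rintro v ⟨σp, hσ, rfl⟩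
    exact H.Von_le hσ e1 e2 e3
  have ha : 0 < a₁ := by linarith [H.h3, H.h32, H.h21]
  have hbi : ∀ t, Integrable (fun ω => if bad a₁ a₂ θ n (fun t => X t ω) t then (1:ℝ) else 0) μ :=
    fun t => Integrable.of_bound (Measurable.ite (H.bad_prob n t).1 measurable_const
      measurable_const).aestronglyMeasurable 1
      (Filter.Eventually.of_forall fun ω => by split_ifs <;> simp)
  have hbv : ∀ t, ∫ ω, (if bad a₁ a₂ θ n (fun t => X t ω) t then (1:ℝ) else 0) ∂μ
      ≤ 2 * r ^ (n - t - 1) := by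
    intro t
    have : (fun ω => if bad a₁ a₂ θ n (fun t => X t ω) t then (1:ℝ) else 0)
        = Set.indicator {ω | bad a₁ a₂ θ n (fun t => X t ω) t} 1 := by
      ext ω; simp [Set.indicator_apply]
    rw [this, integral_indicator_one (H.bad_prob n t).1]
    exact (H.bad_prob n t).2
  have hsum : ∑ t ∈ range n, 2 * r ^ (n - t - 1) ≤ 2 * (1 - r)⁻¹ := by
    rw [← Finset.mul_sum]
    have h1 : ∑ t ∈ range n, r ^ (n - t - 1) = ∑ t ∈ range n, r ^ t := by
      rw [← Finset.sum_range_reflect (fun t => r ^ t) n]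
      refine Finset.sum_congr rfl fun t _ => ?_
      congr 1
      omega
    rw [h1]
    have := Summable.sum_le_tsum (range n) (fun t _ => pow_nonneg hr0 t)
      (summable_geometric_of_lt_one hr0 hr1)
    rw [tsum_geometric_of_lt_one hr0 hr1] at this
    linarith
  have hmain : Voff μ 3 aa X n k ≤ Von μ X n (polB a₁ a₂ a₃ θ X n k)
      + a₁ * ∑ t ∈ range n, 2 * r ^ (n - t - 1) := by
    have hint2 := (integrable_finsetSum (range n) fun t _ => hbi t).const_mul a₁
    calc Voff μ 3 aa X n k = ∫ ω, offV aa X k n ω ∂μ := H.Voff_eq aa k n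
      _ ≤ ∫ ω, (∑ t ∈ range n, X t ω * (polB a₁ a₂ a₃ θ X n k t ω : ℝ)
          + a₁ * ∑ t ∈ range n, (if bad a₁ a₂ θ n (fun t => X t ω) t then (1:ℝ) else 0)) ∂μ := by
        refine integral_mono_ae (H.offV_int aa k n) ((H.pol_int hpol).add hint2) ?_
        filter_upwards [H.ae_val] with ω hω
        rw [offV_eq, e1, e2, e3]
        exact path_upper H.h3 H.h32 H.h21 θ hω n k
      _ = Von μ X n (polB a₁ a₂ a₃ θ X n k) + a₁ * ∑ t ∈ range n,
          ∫ ω, (if bad a₁ a₂ θ n (fun t => X t ω) t then (1:ℝ) else 0) ∂μ := by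
        rw [integral_add (H.pol_int hpol) hint2, integral_const_mul,
          integral_finsetSum _ fun t _ => hbi t]
        rfl
      _ ≤ _ := by
        gcongr with t _
        exact hbv t
  have := mul_le_mul_of_nonneg_left hsum ha.le
  linarith

end Prob
section Lower

variable [MeasurableSpace Ω] {μ : Measure Ω} [IsProbabilityMeasure μ] {a₁ a₂ a₃ ε : ℝ}
  {X U : ℕ → Ω → ℝ}

/-- information of the candidates in a finite set of positions. -/
@[reducible] def FilF (X U : ℕ → Ω → ℝ) (F : Finset ℕ) : MeasurableSpace Ω :=
  MeasurableSpace.comap (fun ω => fun s : F => (X s ω, U s ω)) inferInstance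

lemma measX_FilF {X U : ℕ → Ω → ℝ} {F : Finset ℕ} {s : ℕ} (h : s ∈ F) :
    Measurable[FilF X U F] (fun ω => (X s ω, U s ω)) := by
  have h1 : Measurable[FilF X U F] (fun ω => fun s : F => (X s ω, U s ω)) :=
    comap_measurable _
  exact (measurable_pi_apply (⟨s, h⟩ : F)).comp h1

lemma Hyp.indep_fut (H : Hyp μ a₁ a₂ a₃ ε X U) (h n : ℕ) {f g : Ω → ℝ}
    (hf : Measurable[Fil X U h] f) (hg : Measurable[FilF X U (Ico h n)] g) :
    IndepFun f g μ := by
  have hd : Disjoint (range h) (Ico h n) := by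
    rw [Finset.disjoint_left]
    intro t h1 h2
    rw [Finset.mem_range] at h1
    rw [Finset.mem_Ico] at h2
    omega
  have h1 := H.ind.indepFun_finset (range h) (Ico h n) hd
    (fun t => (H.mX t).prodMk (H.mU t))
  rw [IndepFun_iff_Indep] at h1 ⊢
  refine indep_of_indep_of_le_left (indep_of_indep_of_le_right h1 ?_) ?_
  · exact hg.comap_le
  · refine hf.comap_le.trans (Fil_le fun s hs => ?_)
    exact measX_FilF (F := range h) (Finset.mem_range.2 hs)

lemma Hyp.ind_real (H : Hyp μ a₁ a₂ a₃ ε X U) {A : Set Ω} (hA : MeasurableSet A) :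
    ∫ ω, A.indicator (fun _ => (1:ℝ)) ω ∂μ = μ.real A :=
  integral_indicator_one hA

/-- first half has enough best candidates. -/
lemma Hyp.probG (H : Hyp μ a₁ a₂ a₃ ε X U) {h : ℕ} (hh : ε ^ 2 * h ≤ 1) :
    μ.real {ω | 1 / ε ≤ |∑ t ∈ range h, (if X t ω = a₁ then (1:ℝ) else 0) - h * (1 / 2 - 4 * ε)|}
      ≤ 1 / 4 := by
  have h0 := H.h0
  have b := cheb_aux (fun t => (meas_ind a₁).comp (H.mX t)) (H.indep (meas_ind a₁))
      (fun t ω => by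
        simp only [Function.comp]
        split_ifs <;> simp) (fun t => H.i1 t) (range h) (c := 1 / ε) (by positivity)
  simp only [Function.comp, Finset.card_range] at b
  refine b.trans ?_
  have : (h:ℝ) * ((1 / 2 - 4 * ε) * (1 - (1 / 2 - 4 * ε))) / (1 / ε) ^ 2
    = (ε ^ 2 * h) * (1 / 4 - 16 * ε ^ 2) := by field_simp; ring
  rw [this]
  have := sq_nonneg ε
  have h1 : 0 ≤ ε ^ 2 * h := by positivity
  nlinarith

lemma Hyp.probB (H : Hyp μ a₁ a₂ a₃ ε X U) {n : ℕ} (hn : 1 ≤ ε ^ 2 * n) :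
    μ.real {ω | 2 * ε * n ≤ |∑ t ∈ range n, ((if X t ω = a₁ then (1:ℝ) else 0)
      + (if X t ω = a₂ then (1:ℝ) else 0)) - n * (1 / 2 - 2 * ε)|} ≤ 1 / 16 := by
  have h0 := H.h0
  have h21 := H.h21
  have hn0 : (0:ℝ) < n := by
    by_contra hc
    have : (n:ℝ) = 0 := le_antisymm (not_lt.1 hc) (Nat.cast_nonneg n)
    rw [this] at hn
    linarith
  have m12 : Measurable (fun x : ℝ => (if x = a₁ then (1:ℝ) else 0) +
        (if x = a₂ then (1:ℝ) else 0)) := (meas_ind a₁).add (meas_ind a₂)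
  have b := cheb_aux (fun t => m12.comp (H.mX t)) (H.indep m12)
      (fun t ω => by
        simp only [Function.comp]
        split_ifs with h1 h2 h2
        · linarith
        all_goals simp) (fun t => H.i12 t) (range n) (c := 2 * ε * n) (by positivity)
  simp only [Function.comp, Finset.card_range] at b
  refine b.trans ?_
  rw [div_le_iff₀ (by positivity)]
  have := sq_nonneg ε
  have h1 : (1 / 2 - 2 * ε) * (1 - (1 / 2 - 2 * ε)) ≤ 1 / 4 := by nlinarith
  have h2 : (n:ℝ) * ((1 / 2 - 2 * ε) * (1 - (1 / 2 - 2 * ε))) ≤ n * (1 / 4) := by gcongr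
  nlinarith

lemma Hyp.probG3 (H : Hyp μ a₁ a₂ a₃ ε X U) {h : ℕ} (hh : 8 ≤ ε * h) :
    μ.real {ω | ε * h ≤ |∑ t ∈ range h, (if X t ω = a₂ then (1:ℝ) else 0) - h * (2 * ε)|}
      ≤ 1 / 4 := by
  have h0 := H.h0
  have b := cheb_aux (fun t => (meas_ind a₂).comp (H.mX t)) (H.indep (meas_ind a₂))
      (fun t ω => by
        simp only [Function.comp]
        split_ifs <;> simp) (fun t => H.i2 t) (range h) (c := ε * h) (by linarith)
  simp only [Function.comp, Finset.card_range] at b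
  refine b.trans ?_
  rw [div_le_iff₀ (by nlinarith)]
  nlinarith [sq_nonneg ε, Nat.cast_nonneg (α := ℝ) h]

lemma Hyp.probA2 (H : Hyp μ a₁ a₂ a₃ ε X U) (hε : ε ≤ 1 / 100) {h n : ℕ}
    (h1 : 1 / 2 ≤ ε ^ 2 * (n - h : ℕ)) (h2 : ε ^ 2 * (n - h : ℕ) ≤ 1) :
    Real.exp (-20000) / 4 ≤
      μ.real {ω | 7 / ε ≤ ∑ t ∈ Ico h n, (2 * (if X t ω = a₁ then (1:ℝ) else 0) - 1)} := by
  have b := pz_aux H.h0 hε (fun t => (meas_ind a₁).comp (H.mX t)) (H.indep (meas_ind a₁))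
      (fun t ω => by
        simp only [Function.comp]
        split_ifs <;> simp) (fun t => H.i1 t) (Ico h n) (by simpa using h1) (by simpa using h2)
  simpa only [Function.comp] using b

end Lower
section Gen

lemma mset_G {m : MeasurableSpace Ω} {X : ℕ → Ω → ℝ} {F : Finset ℕ} (a c q : ℝ)
    (hX : ∀ t ∈ F, Measurable[m] (X t)) :
    MeasurableSet[m] {ω | c ≤ |∑ t ∈ F, (if X t ω = a then (1:ℝ) else 0) - q|} := by
  refine measurableSet_le measurable_const ?_
  refine Measurable.abs (Measurable.sub (Finset.measurable_sum _ fun t ht => ?_) measurable_const)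
  exact (meas_ind a).comp (hX t ht)

lemma mset_A {m : MeasurableSpace Ω} {X : ℕ → Ω → ℝ} {F : Finset ℕ} (a c : ℝ)
    (hX : ∀ t ∈ F, Measurable[m] (X t)) :
    MeasurableSet[m] {ω | c ≤ ∑ t ∈ F, (2 * (if X t ω = a then (1:ℝ) else 0) - 1)} := by
  refine measurableSet_le measurable_const (Finset.measurable_sum _ fun t ht => ?_)
  exact (((meas_ind a).comp (hX t ht)).const_mul 2).sub measurable_const

lemma mind {m : MeasurableSpace Ω} {S : Set Ω} (hS : MeasurableSet[m] S) :
    Measurable[m] (S.indicator (fun _ => (1:ℝ))) := measurable_const.indicator hS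

lemma meas_T {m : MeasurableSpace Ω} {X : ℕ → Ω → ℝ} {F : Finset ℕ} {s : ℕ → Ω → ℕ} (a : ℝ)
    (hs : ∀ t ∈ F, Measurable[m] (s t)) (hX : ∀ t ∈ F, Measurable[m] (X t)) :
    Measurable[m] (fun ω => ∑ t ∈ F, (s t ω : ℝ) * (if X t ω = a then (1:ℝ) else 0)) := by
  have hcst : Measurable (fun k : ℕ => (k : ℝ)) := measurable_from_nat
  refine Finset.measurable_sum _ fun t ht => ?_
  exact (hcst.comp (hs t ht)).mul ((meas_ind a).comp (hX t ht))

lemma meas_mul' {m : MeasurableSpace Ω} {f g : Ω → ℝ} (hf : Measurable[m] f)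
    (hg : Measurable[m] g) : Measurable[m] (fun ω => f ω * g ω) := hf.mul hg

end Gen

section Lower2

variable [MeasurableSpace Ω] {μ : Measure Ω} [IsProbabilityMeasure μ] {a₁ a₂ a₃ ε : ℝ}
  {X U : ℕ → Ω → ℝ}

lemma int_of_bd {f : Ω → ℝ} (hf : Measurable f) (C : ℝ) (h0 : ∀ ω, 0 ≤ f ω)
    (h1 : ∀ ω, f ω ≤ C) : Integrable f μ :=
  Integrable.of_bound hf.aestronglyMeasurable C (Filter.Eventually.of_forall fun ω => by
    rw [Real.norm_eq_abs, abs_of_nonneg (h0 ω)]; exact h1 ω)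

lemma cN_cast (a : ℝ) (x : ℕ → ℝ) (F : Finset ℕ) :
    (cN a x F : ℝ) = ∑ t ∈ F, if x t = a then (1:ℝ) else 0 := by
  simp [cN]

set_option maxHeartbeats 2000000 in
lemma Hyp.lower (H : Hyp μ a₁ a₂ a₃ ε X U) (hε : ε ≤ 1 / 100) {n k : ℕ}
    (hn : n = ⌈1 / ε ^ 2⌉₊) (hk : k = ⌈(n : ℝ) / 2⌉₊) {σp : ℕ → Ω → ℕ}
    (hσ : IsPolicy X U n k σp) {aa : ℕ → ℝ} (e1 : aa 1 = a₁) (e2 : aa 2 = a₂) (e3 : aa 3 = a₃) :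
    Von μ X n σp + (min (a₁ - a₂) (a₂ - a₃) * (Real.exp (-20000) / 4) / 8) / ε
      ≤ Voff μ 3 aa X n k := by
  have h0 := H.h0
  have h21 := H.h21
  have h32 := H.h32
  have h3 := H.h3
  have hε2 : 0 < ε ^ 2 := by positivity
  -- numeric facts
  have n1 : 1 ≤ ε ^ 2 * n := by
    have : 1 / ε ^ 2 ≤ (n:ℝ) := by rw [hn]; exact Nat.le_ceil _
    rw [div_le_iff₀ hε2] at this
    linarith
  have n2 : ε ^ 2 * n ≤ 1 + ε ^ 2 := by
    have h := (Nat.ceil_lt_add_one (a := 1 / ε ^ 2) (by positivity)).le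
    rw [← hn] at h
    have := mul_le_mul_of_nonneg_left h hε2.le
    rw [mul_add, mul_one_div_cancel hε2.ne'] at this
    linarith
  have k1 : (n:ℝ) / 2 ≤ k := by rw [hk]; exact Nat.le_ceil _
  have k2 : (k:ℝ) < n / 2 + 1 := by rw [hk]; exact Nat.ceil_lt_add_one (by positivity)
  obtain ⟨h, hh1, hh2⟩ : ∃ h : ℕ, 2 * h ≤ n ∧ n ≤ 2 * h + 1 := ⟨n / 2, by omega, by omega⟩
  have hhn : h ≤ n := by omega
  have r1 : 2 * (h:ℝ) ≤ n := by exact_mod_cast hh1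
  have r2 : (n:ℝ) ≤ 2 * h + 1 := by exact_mod_cast hh2
  have hcast : ((n - h : ℕ) : ℝ) = n - h := by rw [Nat.cast_sub hhn]
  have q1 : ε ^ 2 ≤ 1 / 10000 := by nlinarith
  have s1 : ε ^ 2 * h ≤ 1 := by nlinarith
  have s2 : 1 / 2 ≤ ε ^ 2 * (n - h : ℕ) := by rw [hcast]; nlinarith
  have s3 : ε ^ 2 * (n - h : ℕ) ≤ 1 := by rw [hcast]; nlinarith
  have s4 : 1 / 3 ≤ ε ^ 2 * h := by nlinarith
  have s5 : 1 / (3 * ε) ≤ ε * h := by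
    rw [div_le_iff₀ (by positivity)]; nlinarith
  have s6 : 8 ≤ ε * h := by nlinarith
  have pG := H.probG s1
  have pB := H.probB n1
  have pG3 := H.probG3 s6
  have pA := H.probA2 hε s2 s3
  set p0 := Real.exp (-20000) / 4 with hp0
  have hp0pos : 0 < p0 := by positivity
  have hp1 : p0 ≤ 1 := by
    have : Real.exp (-20000) ≤ 1 := by
      rw [Real.exp_le_one_iff]; norm_num
    linarith
  set Gc := {ω | 1 / ε ≤ |∑ t ∈ range h, (if X t ω = a₁ then (1:ℝ) else 0)
    - h * (1 / 2 - 4 * ε)|} with hGc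
  set Bc := {ω | 2 * ε * n ≤ |∑ t ∈ range n, ((if X t ω = a₁ then (1:ℝ) else 0)
      + (if X t ω = a₂ then (1:ℝ) else 0)) - n * (1 / 2 - 2 * ε)|} with hBc
  set Hc := {ω | ε * h ≤ |∑ t ∈ range h, (if X t ω = a₂ then (1:ℝ) else 0)
    - h * (2 * ε)|} with hHc
  set A := {ω | 7 / ε ≤ ∑ t ∈ Ico h n, (2 * (if X t ω = a₁ then (1:ℝ) else 0) - 1)} with hA
  -- measurability
  have mGF : MeasurableSet[Fil X U h] Gc :=
    mset_G a₁ _ _ fun t ht => measX_Fil (Finset.mem_range.1 ht)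
  have mG : MeasurableSet Gc := H.Fil_le' h _ mGF
  have mB : MeasurableSet Bc := by
    refine measurableSet_le measurable_const (Measurable.abs ?_)
    refine Measurable.sub (Finset.measurable_sum _ fun t ht => ?_) measurable_const
    exact ((meas_ind a₁).comp (H.mX t)).add ((meas_ind a₂).comp (H.mX t))
  have mH : MeasurableSet Hc := mset_G a₂ _ _ fun t _ => H.mX t
  have mAF : MeasurableSet[FilF X U (Ico h n)] A :=
    mset_A a₁ _ fun t ht => measurable_fst.comp (measX_FilF ht)
  have mA : MeasurableSet A := mset_A a₁ _ fun t _ => H.mX t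
  set E := (Gc ∪ Bc ∪ Hc)ᶜ with hE
  have mE : MeasurableSet E := ((mG.union mB).union mH).compl
  have pE : 7 / 16 ≤ μ.real E := by
    rw [hE, probReal_compl_eq_one_sub ((mG.union mB).union mH)]
    have u1 := measureReal_union_le (μ := μ) (Gc ∪ Bc) Hc
    have u2 := measureReal_union_le (μ := μ) Gc Bc
    linarith
  -- functions
  set T : Ω → ℝ := fun ω => ∑ t ∈ range h, (σp t ω : ℝ) * (if X t ω = a₂ then (1:ℝ) else 0) with hT
  set D : Ω → ℝ := fun ω => ∑ t ∈ range h, (1 - (σp t ω : ℝ)) * (if X t ω = a₂ then (1:ℝ) else 0)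
    with hD
  set g : Ω → ℝ := Gcᶜ.indicator (fun _ => 1) with hg
  set b : Ω → ℝ := Bcᶜ.indicator (fun _ => 1) with hb
  set e : Ω → ℝ := E.indicator (fun _ => 1) with he
  set α : Ω → ℝ := A.indicator (fun _ => 1) with hα
  have hcst : Measurable (fun k : ℕ => (k : ℝ)) := measurable_from_nat
  have mTF : Measurable[Fil X U h] T :=
    meas_T a₂ (fun t ht => (hσ.2.1 t).mono (Fil_mono (Finset.mem_range.1 ht)) le_rfl)
      (fun t ht => measX_Fil (Finset.mem_range.1 ht))
  have mT : Measurable T := mTF.mono (H.Fil_le' h) le_rfl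
  have mD : Measurable D := by
    refine Finset.measurable_sum _ fun t ht => ?_
    exact (measurable_const.sub (hcst.comp (H.pol_meas hσ t))).mul ((meas_ind a₂).comp (H.mX t))
  have mgF : Measurable[Fil X U h] g := mind (MeasurableSet.compl mGF)
  have mg : Measurable g := mgF.mono (H.Fil_le' h) le_rfl
  have mb : Measurable b := measurable_const.indicator mB.compl
  have me : Measurable e := measurable_const.indicator mE
  have mαF : Measurable[FilF X U (Ico h n)] α := mind mAF
  have mα : Measurable α := measurable_const.indicator mA
  have ind01 : ∀ (S : Set Ω) ω, 0 ≤ S.indicator (fun _ => (1:ℝ)) ω ∧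
      S.indicator (fun _ => (1:ℝ)) ω ≤ 1 := by
    intro S ω
    by_cases hS : ω ∈ S <;> simp [hS]
  have hσ1 : ∀ t ω, (σp t ω : ℝ) ≤ 1 := fun t ω => by exact_mod_cast hσ.1 t ω
  have T0 : ∀ ω, 0 ≤ T ω := fun ω => Finset.sum_nonneg fun t _ => by
    split_ifs <;> simp
  have D0 : ∀ ω, 0 ≤ D ω := fun ω => Finset.sum_nonneg fun t _ => by
    have := hσ1 t ω
    split_ifs <;> simp [this]
  have TD : ∀ ω, T ω + D ω = ∑ t ∈ range h, (if X t ω = a₂ then (1:ℝ) else 0) := fun ω => by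
    rw [hT, hD]
    simp only [← Finset.sum_add_distrib]
    refine Finset.sum_congr rfl fun t _ => ?_
    ring
  have Zh : ∀ ω, ∑ t ∈ range h, (if X t ω = a₂ then (1:ℝ) else 0) ≤ h := fun ω => by
    rw [← cN_cast a₂ (fun t => X t ω)]
    have := cN_le a₂ (fun t => X t ω) (range h)
    rw [Finset.card_range] at this
    exact_mod_cast this
  have T1 : ∀ ω, T ω ≤ h := fun ω => by linarith [TD ω, Zh ω, D0 ω]
  have D1 : ∀ ω, D ω ≤ h := fun ω => by linarith [TD ω, Zh ω, T0 ω]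
  have mul_int : ∀ {f s : Ω → ℝ}, Measurable f → Measurable s → (∀ ω, 0 ≤ f ω ∧ f ω ≤ h) →
      (∀ ω, 0 ≤ s ω ∧ s ω ≤ 1) → Integrable (fun ω => f ω * s ω) μ := by
    intro f s hf hs hf1 hs1
    refine int_of_bd (hf.mul hs) h (fun ω => mul_nonneg (hf1 ω).1 (hs1 ω).1) fun ω => ?_
    nlinarith [(hf1 ω).1, (hf1 ω).2, (hs1 ω).1, (hs1 ω).2]
  have iTe := mul_int mT me (fun ω => ⟨T0 ω, T1 ω⟩) (ind01 E)
  have iTg := mul_int mT mg (fun ω => ⟨T0 ω, T1 ω⟩) (ind01 _)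
  have iDe := mul_int mD me (fun ω => ⟨D0 ω, D1 ω⟩) (ind01 E)
  have iDb := mul_int mD mb (fun ω => ⟨D0 ω, D1 ω⟩) (ind01 _)
  have iTgα := mul_int (mT.mul mg) mα (fun ω => ⟨mul_nonneg (T0 ω) (ind01 _ ω).1, by
    have := (ind01 Gcᶜ ω)
    simp only [Pi.mul_apply]
    nlinarith [T0 ω, T1 ω]⟩) (ind01 A)
  simp only [Pi.mul_apply] at iTgα
  -- pathwise inequality
  have hpath : ∀ᵐ ω ∂μ, (∑ t ∈ range n, X t ω * (σp t ω : ℝ))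
      + ((a₁ - a₂) * (T ω * g ω * α ω) + (a₂ - a₃) * (D ω * b ω)) ≤ offV aa X k n ω := by
    filter_upwards [H.ae_val] with ω hω
    have hp := path_lower h3 h32 h21 hω (fun t => hσ.1 t ω) (hσ.2.2 ω) hhn
    rw [offV_eq, e1, e2, e3]
    have c1 : g ω * α ω ≤ if k ≤ cN a₁ (fun t => X t ω) (range n) then 1 else 0 := by
      by_cases hG' : ω ∈ Gc
      · have : g ω = 0 := by simp [hg, hG']
        rw [this, zero_mul]
        split_ifs <;> simp
      by_cases hA' : ω ∈ A
      · have hle : k ≤ cN a₁ (fun t => X t ω) (range n) := by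
          have hA2 : 7 / ε ≤ ∑ t ∈ Ico h n, (2 * (if X t ω = a₁ then (1:ℝ) else 0) - 1) := hA'
          have hG2 : |∑ t ∈ range h, (if X t ω = a₁ then (1:ℝ) else 0)
            - h * (1 / 2 - 4 * ε)| < 1 / ε := not_le.1 hG'
          have hG3 := (abs_lt.1 hG2).1
          rw [Finset.sum_sub_distrib, ← Finset.mul_sum, Finset.sum_const, Nat.card_Ico,
            nsmul_eq_mul, hcast] at hA2
          have hZ := Finset.sum_range_add_sum_Ico
            (fun t => if X t ω = a₁ then (1:ℝ) else 0) hhn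
          have hreal : (k:ℝ) ≤ cN a₁ (fun t => X t ω) (range n) := by
            rw [cN_cast]
            have hinv : 1 / ε * ε = 1 := one_div_mul_cancel h0.ne'
            have h7 : 7 / ε = 7 * (1 / ε) := by ring
            rw [h7] at hA2
            have hh8 : 8 * ε * h ≤ 4 * (1 / ε) + 4 * ε := by
              have : 8 * ε * h * ε ≤ (4 * (1 / ε) + 4 * ε) * ε := by nlinarith
              exact le_of_mul_le_mul_right this h0
            have hbig : 100 ≤ 1 / ε := by
              rw [le_div_iff₀ h0]; linarith
            nlinarith
          exact_mod_cast hreal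
        rw [if_pos hle]
        have x1 := ind01 Gcᶜ ω
        have x2 := ind01 A ω
        exact mul_le_one₀ x1.2 x2.1 x2.2
      · have : α ω = 0 := by simp [hα, hA']
        rw [this, mul_zero]
        split_ifs <;> simp
    have c2 : b ω ≤ if cN a₁ (fun t => X t ω) (range n) + cN a₂ (fun t => X t ω) (range n) ≤ k
        then 1 else 0 := by
      by_cases hB' : ω ∈ Bc
      · have : b ω = 0 := by simp [hb, hB']
        rw [this]
        split_ifs <;> simp
      · have hle : cN a₁ (fun t => X t ω) (range n) + cN a₂ (fun t => X t ω) (range n) ≤ k := by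
          have hB2 : |∑ t ∈ range n, ((if X t ω = a₁ then (1:ℝ) else 0)
            + (if X t ω = a₂ then (1:ℝ) else 0)) - n * (1 / 2 - 2 * ε)| < 2 * ε * n := not_le.1 hB'
          have hB3 := (abs_lt.1 hB2).2
          rw [Finset.sum_add_distrib] at hB3
          have hreal : ((cN a₁ (fun t => X t ω) (range n) : ℕ) : ℝ)
              + (cN a₂ (fun t => X t ω) (range n) : ℕ) ≤ k := by
            rw [cN_cast, cN_cast]
            linarith
          exact_mod_cast hreal
        rw [if_pos hle]
        exact (ind01 _ ω).2
    have d1 : (a₁ - a₂) * (T ω * g ω * α ω) ≤ (a₁ - a₂) * T ω *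
        (if k ≤ cN a₁ (fun t => X t ω) (range n) then 1 else 0) := by
      have := mul_le_mul_of_nonneg_left c1 (mul_nonneg (sub_nonneg.2 h21.le) (T0 ω))
      calc _ = (a₁ - a₂) * T ω * (g ω * α ω) := by ring
        _ ≤ _ := this
    have d2 : (a₂ - a₃) * (D ω * b ω) ≤ (a₂ - a₃) * D ω *
        (if cN a₁ (fun t => X t ω) (range n) + cN a₂ (fun t => X t ω) (range n) ≤ k
          then 1 else 0) := by
      have := mul_le_mul_of_nonneg_left c2 (mul_nonneg (sub_nonneg.2 h32.le) (D0 ω))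
      calc _ = (a₂ - a₃) * D ω * b ω := by ring
        _ ≤ _ := this
    refine le_trans ?_ hp
    rw [← add_assoc]
    exact add_le_add (add_le_add le_rfl d1) d2
  have I1 : Von μ X n σp + ((a₁ - a₂) * ∫ ω, T ω * g ω * α ω ∂μ + (a₂ - a₃) * ∫ ω, D ω * b ω ∂μ)
      ≤ Voff μ 3 aa X n k := by
    have j1 := iTgα.const_mul (a₁ - a₂)
    have j2 := iDb.const_mul (a₂ - a₃)
    rw [H.Voff_eq]
    have := integral_mono_ae ((H.pol_int hσ).add (j1.add j2)) (H.offV_int aa k n) hpath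
    refine le_trans (le_of_eq ?_) this
    have z1 := integral_add (H.pol_int hσ) (j1.add j2)
    have z2 := integral_add j1 j2
    rw [integral_const_mul, integral_const_mul] at z2
    rw [← z2]
    exact z1.symm
  -- independence
  have I2 : ∫ ω, T ω * g ω * α ω ∂μ = (∫ ω, T ω * g ω ∂μ) * μ.real A := by
    have hind := H.indep_fut h n (meas_mul' mTF mgF) mαF
    have := hind.integral_fun_mul_eq_mul_integral (mT.mul mg).aestronglyMeasurable
      mα.aestronglyMeasurable
    rw [this, hα, H.ind_real mA]
  have eg : ∀ ω, e ω ≤ g ω := fun ω => by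
    rw [he, hg]
    refine Set.indicator_le_indicator_of_subset ?_ (fun _ => zero_le_one) ω
    intro x hx hx2
    exact hx (Or.inl (Or.inl hx2))
  have eb : ∀ ω, e ω ≤ b ω := fun ω => by
    rw [he, hb]
    refine Set.indicator_le_indicator_of_subset ?_ (fun _ => zero_le_one) ω
    intro x hx hx2
    exact hx (Or.inl (Or.inr hx2))
  have I3 : ∫ ω, T ω * e ω ∂μ ≤ ∫ ω, T ω * g ω ∂μ :=
    integral_mono iTe iTg fun ω => mul_le_mul_of_nonneg_left (eg ω) (T0 ω)
  have I4 : ∫ ω, D ω * e ω ∂μ ≤ ∫ ω, D ω * b ω ∂μ :=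
    integral_mono iDe iDb fun ω => mul_le_mul_of_nonneg_left (eb ω) (D0 ω)
  have PT : 0 ≤ ∫ ω, T ω * e ω ∂μ :=
    integral_nonneg fun ω => mul_nonneg (T0 ω) (ind01 E ω).1
  have PD : 0 ≤ ∫ ω, D ω * e ω ∂μ :=
    integral_nonneg fun ω => mul_nonneg (D0 ω) (ind01 E ω).1
  have I5 : ε * h * μ.real E ≤ ∫ ω, T ω * e ω ∂μ + ∫ ω, D ω * e ω ∂μ := by
    rw [← integral_add iTe iDe, ← H.ind_real mE, ← integral_const_mul]
    refine integral_mono ((int_of_bd me 1 (fun ω => (ind01 E ω).1)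
      (fun ω => (ind01 E ω).2)).const_mul _) (iTe.add iDe) fun ω => ?_
    show ε * h * e ω ≤ T ω * e ω + D ω * e ω
    rw [← add_mul, TD]
    by_cases hω : ω ∈ E
    · have hH : |∑ t ∈ range h, (if X t ω = a₂ then (1:ℝ) else 0) - h * (2 * ε)| < ε * h :=
        not_le.1 fun hx => hω (Or.inr hx)
      have := (abs_lt.1 hH).1
      refine mul_le_mul_of_nonneg_right ?_ (ind01 E ω).1
      linarith
    · have : e ω = 0 := by simp [he, hω]
      rw [this]; simp
  -- conclusion
  set c := min (a₁ - a₂) (a₂ - a₃) with hc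
  have c0 : 0 < c := lt_min (sub_pos.2 h21) (sub_pos.2 h32)
  have F1 : c * p0 * ∫ ω, T ω * e ω ∂μ ≤ (a₁ - a₂) * ∫ ω, T ω * g ω * α ω ∂μ := by
    rw [I2]
    have y1 : p0 * ∫ ω, T ω * e ω ∂μ ≤ (∫ ω, T ω * g ω ∂μ) * μ.real A := by
      rw [mul_comm]
      exact mul_le_mul I3 pA hp0pos.le (PT.trans I3)
    rw [mul_assoc]
    exact mul_le_mul (min_le_left _ _) y1 (mul_nonneg hp0pos.le PT) (sub_nonneg.2 h21.le)
  have F2 : c * p0 * ∫ ω, D ω * e ω ∂μ ≤ (a₂ - a₃) * ∫ ω, D ω * b ω ∂μ := by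
    have y1 : p0 * ∫ ω, D ω * e ω ∂μ ≤ ∫ ω, D ω * b ω ∂μ := by
      refine le_trans ?_ I4
      exact mul_le_of_le_one_left PD hp1
    rw [mul_assoc]
    exact mul_le_mul (min_le_right _ _) y1 (mul_nonneg hp0pos.le PD) (sub_nonneg.2 h32.le)
  have F3 : 1 / (8 * ε) ≤ ε * h * μ.real E := by
    have : 1 / (3 * ε) * (7 / 16) ≤ ε * h * μ.real E :=
      mul_le_mul s5 pE (by norm_num) (by positivity)
    refine le_trans ?_ this
    have v1 : 1 / (8 * ε) = 1 / ε * (1 / 8) := by rw [one_div_mul_one_div, mul_comm]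
    have v2 : 1 / (3 * ε) * (7 / 16) = 1 / ε * (7 / 48) := by rw [mul_comm 3 ε, ← one_div_mul_one_div]; ring
    rw [v1, v2]
    exact mul_le_mul_of_nonneg_left (by norm_num) (by positivity)
  have F4 : (c * p0 / 8) / ε ≤ c * p0 * (∫ ω, T ω * e ω ∂μ + ∫ ω, D ω * e ω ∂μ) := by
    have : (c * p0 / 8) / ε = c * p0 * (1 / (8 * ε)) := by rw [← one_div_mul_one_div]; ring
    rw [this]
    exact mul_le_mul_of_nonneg_left (F3.trans I5) (by positivity)
  rw [mul_add] at F4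
  linarith

end Lower2

/-- Lemma 1, regret lower bound in Kleinberg's example: for the three-point
distribution `(1/2+2ε, 2ε, 1/2-4ε)` on `{a₃ < a₂ < a₁}`, with `n_ε = ⌈1/ε²⌉` and
`k_ε = ⌈n_ε/2⌉`, the regret of the optimal online policy is at least `Γ/ε`; in particular the
supremum of the regret over `𝒯` is at least `Γ/ε`. -/
theorem kleinberg_example_lower_bound (a₁ a₂ a₃ : ℝ)
    (h3 : 0 < a₃) (h32 : a₃ < a₂) (h21 : a₂ < a₁) :
    ∃ Γ ε₀ : ℝ, 0 < Γ ∧ 0 < ε₀ ∧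
      ∀ ε : ℝ, 0 < ε → ε ≤ ε₀ → ε < 1 / 8 →
        ∀ (Ω : Type) [MeasurableSpace Ω] (μ : Measure Ω) [IsProbabilityMeasure μ]
          (X U : ℕ → Ω → ℝ),
          (∀ t, Measurable (X t)) → (∀ t, Measurable (U t)) →
          (∀ t, μ {ω | X t ω = a₁} = ENNReal.ofReal (1 / 2 - 4 * ε)) →
          (∀ t, μ {ω | X t ω = a₂} = ENNReal.ofReal (2 * ε)) →
          (∀ t, μ {ω | X t ω = a₃} = ENNReal.ofReal (1 / 2 + 2 * ε)) →
          (∀ t, μ.map (U t) = volume.restrict (Set.Icc (0 : ℝ) 1)) →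
          iIndepFun (fun t ω => (X t ω, U t ω)) μ →
          (∀ t, IndepFun (X t) (U t) μ) →
          ∀ aa : ℕ → ℝ, aa 1 = a₁ → aa 2 = a₂ → aa 3 = a₃ →
            ∀ nε kε : ℕ, nε = ⌈1 / ε ^ 2⌉₊ → kε = ⌈(nε : ℝ) / 2⌉₊ →
              Γ / ε ≤ Voff μ 3 aa X nε kε - VonStar μ X U nε kε ∧
              Γ / ε ≤ sSup {d : ℝ | ∃ n k : ℕ, k ≤ n ∧
                  d = Voff μ 3 aa X n k - VonStar μ X U n k} := by
  have c0 : 0 < min (a₁ - a₂) (a₂ - a₃) := lt_min (sub_pos.2 h21) (sub_pos.2 h32)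
  refine ⟨min (a₁ - a₂) (a₂ - a₃) * (Real.exp (-20000) / 4) / 8, 1 / 100, by positivity,
    by norm_num, ?_⟩
  intro ε h0 hε h8 Ω _ μ _ X U mX mU d1 d2 d3 _ ind _ aa e1 e2 e3 n k hn hk
  have H : Hyp μ a₁ a₂ a₃ ε X U := ⟨h0, h8, h3, h32, h21, mX, mU, d1, d2, d3, ind⟩
  have first : min (a₁ - a₂) (a₂ - a₃) * (Real.exp (-20000) / 4) / 8 / ε
      ≤ Voff μ 3 aa X n k - VonStar μ X U n k := by
    rw [le_sub_comm]
    refine csSup_le ⟨_, _, polB_policy (a₁ := a₁) (a₂ := a₂) (a₃ := a₃) 0 n k, rfl⟩ ?_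
    rintro v ⟨σp, hσ, rfl⟩
    have := H.lower hε hn hk hσ e1 e2 e3
    linarith
  refine ⟨first, first.trans (le_csSup ⟨a₁ * (2 * (1 - Real.exp (-(2 * ε ^ 2)))⁻¹), ?_⟩
    ⟨n, k, ?_, rfl⟩)⟩
  · rintro d ⟨n', k', _, rfl⟩
    exact H.bdd e1 e2 e3 n' k'
  · rw [hk, Nat.ceil_le]
    have : (0:ℝ) ≤ n := Nat.cast_nonneg n
    linarith

end MultiSecretary
end
end

section
/- Fix j ∈ [m]. For all (n,k) ∈ 𝒯_j one has the bounds Σ_{i∈[j−1]} E[Z_i^n] − 1/(4ε) ≤ Σ_{i∈[j−1]} E[𝔖_i^n] and Σ_{i=j+2}^m E[𝔖_i^n] ≤ 1/(4ε). Consequently, for all (n,k) ∈ 𝒯_j, |V_off^*(n,k) − (Σ_{i∈[j−1]} a_i E[Z_i^n] + a_j E[𝔖_j^n] + a_{j+1} E[𝔖_{j+1}^n])| ≤ a_1/(4ε). -/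
open MeasureTheory ProbabilityTheory Finset

noncomputable section

namespace MultiSecretary

variable {Ω : Type*}

theorem Zc_meas [MeasurableSpace Ω] {X : ℕ → Ω → ℝ} (hX : ∀ t, Measurable (X t)) (x : ℝ) (r : ℕ) :
    Measurable (Zc X x r) := by
  unfold Zc
  refine Finset.measurable_sum _ fun t _ => ?_
  exact Measurable.ite (hX t (measurableSet_singleton x)) measurable_const measurable_const

theorem Zc_nonneg (X : ℕ → Ω → ℝ) (x : ℝ) (r : ℕ) (ω : Ω) : 0 ≤ Zc X x r ω := by
  unfold Zc
  exact Finset.sum_nonneg fun t _ => by split_ifs <;> norm_num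

theorem Zc_le (X : ℕ → Ω → ℝ) (x : ℝ) (r : ℕ) (ω : Ω) : Zc X x r ω ≤ r := by
  unfold Zc
  calc _ ≤ ∑ t ∈ range r, (1 : ℝ) := Finset.sum_le_sum fun t _ => by split_ifs <;> norm_num
    _ = r := by simp

theorem Soff_nonneg (a : ℕ → ℝ) (X : ℕ → Ω → ℝ) (k r j : ℕ) (ω : Ω) : 0 ≤ Soff a X k r j ω :=
  le_min (Zc_nonneg _ _ _ _) (le_max_right _ _)

theorem Soff_le (a : ℕ → ℝ) (X : ℕ → Ω → ℝ) (k r j : ℕ) (ω : Ω) :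
    Soff a X k r j ω ≤ Zc X (a j) r ω := min_le_left _ _

theorem Zc_int [MeasurableSpace Ω] {μ : Measure Ω} [IsProbabilityMeasure μ] {X : ℕ → Ω → ℝ}
    (hX : ∀ t, Measurable (X t)) (x : ℝ) (r : ℕ) : Integrable (Zc X x r) μ := by
  refine Integrable.of_bound (Zc_meas hX x r).aestronglyMeasurable (r : ℝ) (ae_of_all _ fun ω => ?_)
  rw [Real.norm_of_nonneg (Zc_nonneg _ _ _ _)]
  exact Zc_le _ _ _ _

theorem Soff_int [MeasurableSpace Ω] {μ : Measure Ω} [IsProbabilityMeasure μ] (a : ℕ → ℝ)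
    {X : ℕ → Ω → ℝ} (hX : ∀ t, Measurable (X t)) (k r j : ℕ) : Integrable (Soff a X k r j) μ := by
  have hmeas : Measurable (Soff a X k r j) := by
    unfold Soff
    refine (Zc_meas hX _ r).min ((Measurable.sub measurable_const ?_).max measurable_const)
    exact Finset.measurable_sum _ fun i _ => Zc_meas hX _ r
  refine Integrable.of_bound hmeas.aestronglyMeasurable (r : ℝ) (ae_of_all _ fun ω => ?_)
  rw [Real.norm_of_nonneg (Soff_nonneg _ _ _ _ _ _)]
  exact (Soff_le _ _ _ _ _ _).trans (Zc_le _ _ _ _)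

theorem Soff_sum (a : ℕ → ℝ) (X : ℕ → Ω → ℝ) (k r l : ℕ) (ω : Ω) :
    ∑ i ∈ Icc 1 l, Soff a X k r i ω = min (∑ i ∈ Icc 1 l, Zc X (a i) r ω) k := by
  induction l with
  | zero => simp
  | succ l ih =>
    rw [Finset.sum_Icc_succ_top (by omega), Finset.sum_Icc_succ_top (by omega), ih]
    unfold Soff
    rw [Nat.add_sub_cancel]
    have h1 := Zc_nonneg X (a (l + 1)) r ω
    generalize ∑ i ∈ Icc 1 l, Zc X (a i) r ω = B
    generalize Zc X (a (l + 1)) r ω = z at *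
    have hk : (0 : ℝ) ≤ k := Nat.cast_nonneg k
    generalize (k : ℝ) = K at *
    simp only [min_def, max_def]
    split_ifs <;> linarith

theorem split_sum (g : ℕ → ℝ) (m j : ℕ) (hj1 : 1 ≤ j) (hjm : j ≤ m) :
    ∑ i ∈ Icc 1 m, g i = ∑ i ∈ Icc 1 (j - 1), g i + g j + (if j + 1 ≤ m then g (j + 1) else 0)
      + ∑ i ∈ Icc (j + 2) m, g i := by
  obtain ⟨j, rfl⟩ : ∃ q, j = q + 1 := ⟨j - 1, by omega⟩
  rw [Nat.add_sub_cancel]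
  obtain ⟨d, rfl⟩ := Nat.exists_eq_add_of_le hjm
  induction d with
  | zero => simp [Finset.sum_Icc_succ_top]
  | succ d ih =>
    rw [← add_assoc, Finset.sum_Icc_succ_top (by omega), ih (by omega)]
    rcases Nat.eq_zero_or_pos d with rfl | hd
    · simp
    · rw [Finset.sum_Icc_succ_top (b := j + 1 + d) (by omega), if_pos (by omega), if_pos (by omega)]
      ring

theorem a_lt {m : ℕ} {a : ℕ → ℝ} (h : ∀ j, 1 ≤ j → j < m → a (j + 1) < a j) (i j : ℕ)
    (hi : 1 ≤ i) (hij : i < j) (hj : j ≤ m) : a j < a i := by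
  induction j, hij using Nat.le_induction with
  | base => exact h i hi (by omega)
  | succ j hjj ih => exact (h j (by omega) (by omega)).trans (ih (by omega))

def gA (a : ℕ → ℝ) (l : ℕ) (x : ℝ) : ℝ := ∑ i ∈ Icc 1 l, if x = a i then 1 else 0

theorem gA_mem {m : ℕ} {a : ℕ → ℝ} (h : ∀ j, 1 ≤ j → j < m → a (j + 1) < a j) (l : ℕ)
    (hl : l ≤ m) (x : ℝ) : gA a l x ∈ Set.Icc (0 : ℝ) 1 := by
  unfold gA
  by_cases hx : ∃ i ∈ Icc 1 l, x = a i
  · obtain ⟨i, hi, rfl⟩ := hx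
    rw [Finset.sum_eq_single i]
    · simp
    · intro b hb hbi
      rw [if_neg]
      simp only [Finset.mem_Icc] at hi hb
      rcases lt_or_gt_of_ne hbi with hlt | hlt
      · exact (a_lt h b i hb.1 hlt (by omega)).ne
      · exact (a_lt h i b hi.1 hlt (by omega)).ne'
    · exact fun hc => absurd hi hc
  · push Not at hx
    rw [Finset.sum_eq_zero fun i hi => if_neg (hx i hi)]
    simp

theorem gA_meas (a : ℕ → ℝ) (l : ℕ) : Measurable (gA a l) := by
  unfold gA
  refine Finset.measurable_sum _ fun t _ => ?_
  exact Measurable.ite (measurableSet_singleton _) measurable_const measurable_const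

theorem W_eq (a : ℕ → ℝ) (X : ℕ → Ω → ℝ) (l n : ℕ) :
    (fun ω => ∑ i ∈ Icc 1 l, Zc X (a i) n ω) = ∑ t ∈ range n, gA a l ∘ X t := by
  ext ω
  simp only [Zc, gA, Finset.sum_apply, Function.comp]
  exact Finset.sum_comm

theorem Zc_mean [MeasurableSpace Ω] {μ : Measure Ω} {m : ℕ} {a f : ℕ → ℝ} {X : ℕ → Ω → ℝ}
    (hM : ModelX μ m a f X) (i n : ℕ) (hi : 1 ≤ i) (him : i ≤ m) :
    ∫ ω, Zc X (a i) n ω ∂μ = n * f i := by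
  have := hM.hprob
  unfold Zc
  have hms : ∀ t, MeasurableSet {ω | X t ω = a i} := fun t =>
    hM.hXmeas t (measurableSet_singleton (a i))
  have he : ∀ t, (fun ω => if X t ω = a i then (1 : ℝ) else 0) =
      Set.indicator {ω | X t ω = a i} (fun _ => 1) := by
    intro t; ext ω; simp [Set.indicator]
  rw [integral_finsetSum]
  · have : ∀ t, ∫ ω, (if X t ω = a i then (1 : ℝ) else 0) ∂μ = f i := by
      intro t
      rw [he, integral_indicator (hms t)]
      simp [Measure.real, hM.hXdist t i hi him, (hM.hf_pos i hi him).le]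
    simp [this]
  · intro t _
    rw [he]
    exact (integrable_const _).indicator (hms t)

theorem W_facts [MeasurableSpace Ω] {μ : Measure Ω} {m : ℕ} {a f : ℕ → ℝ} {X : ℕ → Ω → ℝ}
    (hM : ModelX μ m a f X) (l n : ℕ) (hl : l ≤ m) :
    MemLp (fun ω => ∑ i ∈ Icc 1 l, Zc X (a i) n ω) 2 μ ∧
    ∫ ω, (∑ i ∈ Icc 1 l, Zc X (a i) n ω) ∂μ = n * ∑ i ∈ Icc 1 l, f i ∧
    variance (fun ω => ∑ i ∈ Icc 1 l, Zc X (a i) n ω) μ ≤ n := by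
  have := hM.hprob
  have hmem : ∀ t, ∀ ω, (gA a l ∘ X t) ω ∈ Set.Icc (0 : ℝ) 1 := fun t ω => gA_mem hM.ha_anti l hl _
  have hmeas : ∀ t, Measurable (gA a l ∘ X t) := fun t => (gA_meas a l).comp (hM.hXmeas t)
  have hL : ∀ t, MemLp (gA a l ∘ X t) 2 μ := fun t => by
    refine MemLp.of_bound (hmeas t).aestronglyMeasurable 1 (ae_of_all _ fun ω => ?_)
    rw [Real.norm_of_nonneg (hmem t ω).1]
    exact (hmem t ω).2
  refine ⟨?_, ?_, ?_⟩
  · rw [W_eq]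
    exact memLp_finsetSum' _ fun t _ => hL t
  · rw [integral_finsetSum _ fun i _ => Zc_int hM.hXmeas _ _, Finset.mul_sum]
    refine Finset.sum_congr rfl fun i hi => ?_
    simp only [Finset.mem_Icc] at hi
    exact Zc_mean hM i n hi.1 (by omega)
  · rw [W_eq, IndepFun.variance_sum (fun t _ => hL t)]
    · calc _ ≤ ∑ t ∈ range n, (1 : ℝ) := by
            refine Finset.sum_le_sum fun t _ => ?_
            refine (variance_le_sq_of_bounded (a := 0) (b := 1) (ae_of_all _ (hmem t))
              (hmeas t).aemeasurable).trans (by norm_num)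
        _ = n := by simp
    · intro s _ t _ hst
      exact (hM.hIndep.indepFun hst).comp (gA_meas a l) (gA_meas a l)

theorem tail_bound [MeasurableSpace Ω] {μ : Measure Ω} [IsProbabilityMeasure μ] {W : Ω → ℝ}
    (hW : MemLp W 2 μ) {M v c : ℝ} (hMean : ∫ ω, W ω ∂μ = M) (hv : variance W μ ≤ v) (hc : 0 < c)
    {D : Ω → ℝ} (hD : Integrable D μ)
    (hDle : ∀ ω, D ω ≤ max (|W ω - M| - c) 0) : ∫ ω, D ω ∂μ ≤ v / (4 * c) := by
  have hsq : Integrable (fun ω => (W ω - M) ^ 2) μ := (hW.sub (memLp_const M)).integrable_sq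
  calc ∫ ω, D ω ∂μ ≤ ∫ ω, (W ω - M) ^ 2 / (4 * c) ∂μ := by
        refine integral_mono hD (hsq.div_const _) fun ω => (hDle ω).trans ?_
        rw [le_div_iff₀ (by positivity), ← sq_abs (W ω - M)]
        rcases max_cases (|W ω - M| - c) 0 with ⟨h, _⟩ | ⟨h, _⟩ <;> rw [h]
        · nlinarith [sq_nonneg (|W ω - M| - 2 * c)]
        · simpa using sq_nonneg _
    _ = variance W μ / (4 * c) := by
        rw [integral_div, variance_eq_integral hW.aestronglyMeasurable.aemeasurable, hMean]
    _ ≤ v / (4 * c) := by gcongr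

theorem minf_facts {m : ℕ} {f : ℕ → ℝ} (hm : 1 ≤ m) (hf : ∀ j, 1 ≤ j → j ≤ m → 0 < f j) :
    0 < minf m f ∧ ∀ j, 1 ≤ j → j ≤ m → minf m f ≤ f j := by
  have hset : {x : ℝ | ∃ j, 1 ≤ j ∧ j ≤ m ∧ x = f j} = Set.image f (Icc 1 m : Finset ℕ) := by
    ext x; simp only [Set.mem_setOf_eq, Set.mem_image, Finset.mem_coe, Finset.mem_Icc]
    constructor
    · rintro ⟨j, h1, h2, rfl⟩; exact ⟨j, ⟨h1, h2⟩, rfl⟩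
    · rintro ⟨j, ⟨h1, h2⟩, rfl⟩; exact ⟨j, h1, h2, rfl⟩
  have hfin : (Set.image f (Icc 1 m : Finset ℕ)).Finite := (Finset.finite_toSet _).image _
  have hne : (Set.image f (Icc 1 m : Finset ℕ)).Nonempty := ⟨f 1, 1, by simp [hm], rfl⟩
  unfold minf
  rw [hset]
  constructor
  · obtain ⟨i, hi, he⟩ := hne.csInf_mem hfin
    rw [← he]
    simp only [Finset.mem_coe, Finset.mem_Icc] at hi
    exact hf i hi.1 hi.2
  · intro j h1 h2
    exact csInf_le hfin.bddBelow ⟨j, by simp [h1, h2], rfl⟩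

/-- Proposition 1, offline sort decomposition: for `(n,k) ∈ 𝒯_j`
(i.e. `j₀(n,k) = j`), the offline sort takes almost all values above `a_j` and almost no
values below `a_{j+1}`, and the offline value decomposes accordingly up to `a_1/(4ε)`
(for `j = m` the `a_{j+1}` term is absent). -/
theorem offline_sort_decomposition {Ω : Type*} [MeasurableSpace Ω] (μ : Measure Ω)
    (m : ℕ) (a f : ℕ → ℝ) (X : ℕ → Ω → ℝ) (hM : ModelX μ m a f X)
    (ε : ℝ) (hε : ε = minf m f / 2)
    (j : ℕ) (hj1 : 1 ≤ j) (hjm : j ≤ m)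
    (n k : ℕ) (hn : 0 < n) (hkn : k ≤ n) (hmem : J0Spec m f n k j) :
    ((∑ i ∈ Icc 1 (j - 1), ∫ ω, Zc X (a i) n ω ∂μ) - 1 / (4 * ε) ≤
        ∑ i ∈ Icc 1 (j - 1), ∫ ω, Soff a X k n i ω ∂μ) ∧
    ((∑ i ∈ Icc (j + 2) m, ∫ ω, Soff a X k n i ω ∂μ) ≤ 1 / (4 * ε)) ∧
    |Voff μ m a X n k -
        ((∑ i ∈ Icc 1 (j - 1), a i * ∫ ω, Zc X (a i) n ω ∂μ) +
          a j * ∫ ω, Soff a X k n j ω ∂μ +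
          (if j + 1 ≤ m then a (j + 1) * ∫ ω, Soff a X k n (j + 1) ω ∂μ else 0))|
      ≤ a 1 / (4 * ε) := by
  have := hM.hprob
  obtain ⟨hmin0, hmin⟩ := minf_facts hM.hm hM.hf_pos
  have hε0 : 0 < ε := by rw [hε]; linarith
  have hnR : (0 : ℝ) < n := by exact_mod_cast hn
  have hXm := hM.hXmeas
  have hbnd : (n : ℝ) / (4 * (n * ε)) = 1 / (4 * ε) := by field_simp
  have hεf : ∀ i, 1 ≤ i → i ≤ m → ε ≤ f i / 2 := fun i h1 h2 => by
    rw [hε]; have := hmin i h1 h2; linarith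
  have hpos : 0 ≤ 1 / (4 * ε) := by positivity
  -- first bound
  have A1 : (∑ i ∈ Icc 1 (j - 1), ∫ ω, Zc X (a i) n ω ∂μ) - 1 / (4 * ε) ≤
        ∑ i ∈ Icc 1 (j - 1), ∫ ω, Soff a X k n i ω ∂μ := by
    by_cases hj : j = 1
    · subst hj; simpa using hε0.le
    have hk : n * Fbar f j + n * ε ≤ k := by
      have h1 : Fbar f j + f j / 2 ≤ (k : ℝ) / n := by
        rcases hmem with h | h | h
        · exact absurd h.1 hj
        · exact h.2.2.1
        · obtain ⟨rfl, h⟩ := h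
          have hs := hM.hf_sum
          obtain ⟨j, rfl⟩ : ∃ q, j = q + 1 := ⟨j - 1, by omega⟩
          rw [Finset.sum_Icc_succ_top (by omega)] at hs
          unfold Fbar
          rw [Nat.add_sub_cancel]
          linarith
      rw [le_div_iff₀ hnR] at h1
      have h2 := mul_le_mul_of_nonneg_left (hεf j hj1 hjm) hnR.le
      linarith
    obtain ⟨hL, hE, hV⟩ := W_facts hM (j - 1) n (by omega)
    have hD : Integrable (fun ω => ∑ i ∈ Icc 1 (j - 1), Zc X (a i) n ω -
        ∑ i ∈ Icc 1 (j - 1), Soff a X k n i ω) μ :=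
      (integrable_finsetSum _ fun i _ => Zc_int hXm _ _).sub
        (integrable_finsetSum _ fun i _ => Soff_int a hXm _ _ _)
    have key := tail_bound hL hE hV (mul_pos hnR hε0) hD (fun ω => by
      rw [Soff_sum]
      unfold Fbar at hk
      have := le_abs_self (∑ i ∈ Icc 1 (j - 1), Zc X (a i) n ω - n * ∑ i ∈ Icc 1 (j - 1), f i)
      rcases min_cases (∑ i ∈ Icc 1 (j - 1), Zc X (a i) n ω) (k : ℝ) with h | h
      · rw [h.1]; simp
      · rw [h.1]; refine le_trans ?_ (le_max_left _ _); linarith)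
    rw [integral_sub (integrable_finsetSum _ fun i _ => Zc_int hXm _ _)
      (integrable_finsetSum _ fun i _ => Soff_int a hXm _ _ _),
      integral_finsetSum _ fun i _ => Zc_int hXm _ _,
      integral_finsetSum _ fun i _ => Soff_int a hXm _ _ _, hbnd] at key
    linarith
  have A2 : (∑ i ∈ Icc (j + 2) m, ∫ ω, Soff a X k n i ω ∂μ) ≤ 1 / (4 * ε) := by
    by_cases hj : m < j + 2
    · rw [Finset.Icc_eq_empty (by omega)]; simpa using hε0.le
    push Not at hj
    have hk : k ≤ n * (∑ i ∈ Icc 1 (j + 1), f i) - n * ε := by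
      have h1 : (k : ℝ) / n ≤ (∑ i ∈ Icc 1 (j + 1), f i) - f (j + 1) / 2 := by
        rcases hmem with h | h | h
        · obtain ⟨rfl, h⟩ := h
          rw [Finset.sum_Icc_succ_top (by omega)]
          simp only [Icc_self, sum_singleton]
          norm_num at h ⊢
          linarith
        · exact h.2.2.2.le
        · omega
      rw [div_le_iff₀ hnR] at h1
      have h2 := mul_le_mul_of_nonneg_left (hεf (j + 1) (by omega) (by omega)) hnR.le
      linarith
    obtain ⟨hL, hE, hV⟩ := W_facts hM (j + 1) n (by omega)
    have hD : Integrable (fun ω => ∑ i ∈ Icc (j + 2) m, Soff a X k n i ω) μ :=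
      integrable_finsetSum _ fun i _ => Soff_int a hXm _ _ _
    have key := tail_bound hL hE hV (mul_pos hnR hε0) hD (fun ω => by
      have hs := split_sum (fun i => Soff a X k n i ω) m j hj1 hjm
      have h1 := Soff_sum a X k n m ω
      have h2 := Soff_sum a X k n (j + 1) ω
      have hs2 := split_sum (fun i => Soff a X k n i ω) (j + 1) j hj1 (by omega)
      rw [if_pos (by omega)] at hs hs2
      rw [Finset.Icc_eq_empty (a := j + 2) (b := j + 1) (by omega), Finset.sum_empty] at hs2
      have h3 := min_le_right (∑ i ∈ Icc 1 m, Zc X (a i) n ω) (k : ℝ)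
      have h4 := neg_abs_le (∑ i ∈ Icc 1 (j + 1), Zc X (a i) n ω - n * ∑ i ∈ Icc 1 (j + 1), f i)
      rcases min_cases (∑ i ∈ Icc 1 (j + 1), Zc X (a i) n ω) (k : ℝ) with h | h
      · refine le_trans ?_ (le_max_left _ _); linarith
      · refine le_trans ?_ (le_max_right _ _); linarith)
    rw [integral_finsetSum _ fun i _ => Soff_int a hXm _ _ _, hbnd] at key
    exact key
  refine ⟨A1, A2, ?_⟩
  have ha1 : ∀ i, 1 ≤ i → i ≤ m → a i ≤ a 1 := fun i h1 h2 => by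
    rcases h1.eq_or_lt with rfl | h
    · exact le_rfl
    · exact (a_lt hM.ha_anti 1 i le_rfl h h2).le
  have ha0 : ∀ i, 1 ≤ i → i ≤ m → 0 ≤ a i := fun i h1 h2 => by
    rcases h2.eq_or_lt with rfl | h
    · exact hM.ha_pos.le
    · exact (hM.ha_pos.trans (a_lt hM.ha_anti i m h1 h le_rfl)).le
  have hS0 : ∀ i, 0 ≤ ∫ ω, Soff a X k n i ω ∂μ := fun i =>
    integral_nonneg fun ω => Soff_nonneg _ _ _ _ _ _
  have hSZ : ∀ i, 0 ≤ ∫ ω, Zc X (a i) n ω ∂μ - ∫ ω, Soff a X k n i ω ∂μ := fun i =>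
    sub_nonneg.2 (integral_mono (Soff_int a hXm _ _ _) (Zc_int hXm _ _) fun ω => Soff_le _ _ _ _ _ _)
  have h10 := ha0 1 le_rfl hM.hm
  have B1 : 0 ≤ ∑ i ∈ Icc 1 (j - 1),
      a i * (∫ ω, Zc X (a i) n ω ∂μ - ∫ ω, Soff a X k n i ω ∂μ) := by
    refine Finset.sum_nonneg fun i hi => ?_
    simp only [Finset.mem_Icc] at hi
    exact mul_nonneg (ha0 i hi.1 (by omega)) (hSZ i)
  have B2 : ∑ i ∈ Icc 1 (j - 1),
      a i * (∫ ω, Zc X (a i) n ω ∂μ - ∫ ω, Soff a X k n i ω ∂μ) ≤ a 1 * (1 / (4 * ε)) := by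
    refine (Finset.sum_le_sum (g := fun i => a 1 * (∫ ω, Zc X (a i) n ω ∂μ - ∫ ω, Soff a X k n i ω ∂μ))
      fun i hi => ?_).trans ?_
    · simp only [Finset.mem_Icc] at hi
      exact mul_le_mul_of_nonneg_right (ha1 i hi.1 (by omega)) (hSZ i)
    · rw [← Finset.mul_sum, Finset.sum_sub_distrib]
      exact mul_le_mul_of_nonneg_left (by linarith) h10
  have C1 : 0 ≤ ∑ i ∈ Icc (j + 2) m, a i * ∫ ω, Soff a X k n i ω ∂μ := by
    refine Finset.sum_nonneg fun i hi => ?_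
    simp only [Finset.mem_Icc] at hi
    exact mul_nonneg (ha0 i (by omega) (by omega)) (hS0 i)
  have C2 : ∑ i ∈ Icc (j + 2) m, a i * ∫ ω, Soff a X k n i ω ∂μ ≤ a 1 * (1 / (4 * ε)) := by
    refine (Finset.sum_le_sum (g := fun i => a 1 * ∫ ω, Soff a X k n i ω ∂μ)
      fun i hi => ?_).trans ?_
    · simp only [Finset.mem_Icc] at hi
      exact mul_le_mul_of_nonneg_right (ha1 i (by omega) (by omega)) (hS0 i)
    · rw [← Finset.mul_sum]
      exact mul_le_mul_of_nonneg_left A2 h10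
  have hV : Voff μ m a X n k = _ :=
    split_sum (fun i => a i * ∫ ω, Soff a X k n i ω ∂μ) m j hj1 hjm
  rw [hV]
  simp only [mul_sub, Finset.sum_sub_distrib] at B1 B2
  rw [mul_one_div] at B2 C2
  rw [abs_le]
  constructor <;> linarith

end MultiSecretary
end
end

section
/- Let B be a binomial random variable with n trials and success probability p, let k be a nonnegative integer, and let ε' > 0. If p + ε' ≤ k/n, then E[(B − k)_+] ≤ 1/(4ε'). If k/n ≤ p − ε', then E[(k − B)_+] ≤ 1/(4ε'). -/
open MeasureTheory ProbabilityTheory Finset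

noncomputable section

namespace MultiSecretary

variable {Ω : Type*}

lemma binomial_integral_aux {Ω : Type*} [MeasurableSpace Ω] (μ : Measure Ω)
    [IsProbabilityMeasure μ] (n : ℕ) (p : ℝ) (hp0 : 0 ≤ p) (hp1 : p ≤ 1)
    (B : Ω → ℕ) (hBmeas : Measurable B)
    (hB : ∀ i : ℕ, μ {ω | B ω = i} =
      ENNReal.ofReal ((n.choose i : ℝ) * p ^ i * (1 - p) ^ (n - i))) (g : ℕ → ℝ) :
    ∫ ω, g (B ω) ∂μ =
      ∑ i ∈ range (n + 1), ((n.choose i : ℝ) * p ^ i * (1 - p) ^ (n - i)) * g i := by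
  have hq : 0 ≤ 1 - p := by linarith
  have hms : ∀ i, MeasurableSet {ω | B ω = i} := fun i => hBmeas (measurableSet_singleton i)
  have hle : ∀ᵐ ω ∂μ, B ω ≤ n := by
    have h : ∀ i : ℕ, ∀ᵐ ω ∂μ, n < i → B ω ≠ i := by
      intro i
      by_cases hi : n < i
      · have h0 : μ {ω | B ω = i} = 0 := by
          rw [hB, Nat.choose_eq_zero_of_lt hi]; simp
        rw [ae_iff]
        refine measure_mono_null ?_ h0
        intro ω hω
        simpa [hi] using hω
      · exact Filter.Eventually.of_forall fun ω h => absurd h hi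
    filter_upwards [ae_all_iff.2 h] with ω hω
    by_contra! hc
    exact hω _ hc rfl
  have hae : (fun ω => g (B ω)) =ᵐ[μ]
      fun ω => ∑ i ∈ range (n + 1), Set.indicator {ω | B ω = i} (fun _ => g i) ω := by
    filter_upwards [hle] with ω hω
    have : ∀ i, Set.indicator {ω | B ω = i} (fun _ => g i) ω = if B ω = i then g i else 0 := by
      intro i; simp [Set.indicator_apply]
    simp only [this]
    rw [Finset.sum_ite_eq, if_pos (by simp; omega)]
  rw [integral_congr_ae hae, integral_finset_sum]
  · refine Finset.sum_congr rfl fun i _ => ?_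
    rw [integral_indicator_const _ (hms i), measureReal_def, hB, ENNReal.toReal_ofReal, smul_eq_mul]
    positivity
  · intro i _
    exact (integrable_const _).indicator (hms i)

lemma binomial_var_aux (n : ℕ) (p : ℝ) :
    ∑ i ∈ range (n + 1), ((n.choose i : ℝ) * p ^ i * (1 - p) ^ (n - i)) * ((n : ℝ) * p - i) ^ 2
      = n * p * (1 - p) := by
  have h := congrArg (Polynomial.eval p) (bernsteinPolynomial.variance ℝ n)
  simp [bernsteinPolynomial, Polynomial.eval_finset_sum] at h
  rw [← h]
  exact Finset.sum_congr rfl fun i _ => by ring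

lemma binomial_bound_aux {Ω : Type*} [MeasurableSpace Ω] (μ : Measure Ω)
    [IsProbabilityMeasure μ] (n : ℕ) (hn : 1 ≤ n) (p : ℝ) (hp0 : 0 ≤ p) (hp1 : p ≤ 1)
    (B : Ω → ℕ) (hBmeas : Measurable B)
    (hB : ∀ i : ℕ, μ {ω | B ω = i} =
      ENNReal.ofReal ((n.choose i : ℝ) * p ^ i * (1 - p) ^ (n - i))) (g : ℕ → ℝ)
    (e : ℝ) (he : 0 < e) (hg : ∀ i, g i ≤ ((n : ℝ) * p - i) ^ 2 / (4 * (n * e))) :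
    ∫ ω, g (B ω) ∂μ ≤ 1 / (4 * e) := by
  have hq : 0 ≤ 1 - p := by linarith
  have hn' : (0 : ℝ) < n := by exact_mod_cast hn
  rw [binomial_integral_aux μ n p hp0 hp1 B hBmeas hB]
  calc _ ≤ ∑ i ∈ range (n + 1), ((n.choose i : ℝ) * p ^ i * (1 - p) ^ (n - i)) *
            (((n : ℝ) * p - i) ^ 2 / (4 * (n * e))) :=
        Finset.sum_le_sum fun i _ => mul_le_mul_of_nonneg_left (hg i) (by positivity)
    _ = (n * p * (1 - p)) / (4 * (n * e)) := by
        rw [← binomial_var_aux, Finset.sum_div]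
        exact Finset.sum_congr rfl fun i _ => by ring
    _ = p * (1 - p) / (4 * e) := by field_simp
    _ ≤ 1 / (4 * e) := by
        gcongr
        nlinarith

lemma pos_part_aux (x d c : ℝ) (hc : 0 < c) (hd : c ≤ d) : max (x - d) 0 ≤ x ^ 2 / (4 * c) := by
  apply max_le
  · rw [le_div_iff₀ (by positivity)]
    nlinarith [sq_nonneg (x - 2 * c)]
  · positivity

/-- Lemma 2 of Arlotto–Gurvich: if `B` is binomial with `n` trials and
success probability `p`, then `E[(B-k)_+] ≤ 1/(4ε')` whenever `p + ε' ≤ k/n`, and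
`E[(k-B)_+] ≤ 1/(4ε')` whenever `k/n ≤ p - ε'`. -/
theorem binomial_overshoot_bound {Ω : Type*} [MeasurableSpace Ω] (μ : Measure Ω)
    [IsProbabilityMeasure μ] (n : ℕ) (hn : 1 ≤ n) (p : ℝ) (hp0 : 0 ≤ p) (hp1 : p ≤ 1)
    (B : Ω → ℕ) (hBmeas : Measurable B)
    (hB : ∀ i : ℕ, μ {ω | B ω = i} =
      ENNReal.ofReal ((n.choose i : ℝ) * p ^ i * (1 - p) ^ (n - i)))
    (k : ℕ) (ε' : ℝ) (hε' : 0 < ε') :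
    (p + ε' ≤ (k : ℝ) / (n : ℝ) →
      ∫ ω, max ((B ω : ℝ) - (k : ℝ)) 0 ∂μ ≤ 1 / (4 * ε')) ∧
    ((k : ℝ) / (n : ℝ) ≤ p - ε' →
      ∫ ω, max ((k : ℝ) - (B ω : ℝ)) 0 ∂μ ≤ 1 / (4 * ε')) := by
  have hn' : (0 : ℝ) < n := by exact_mod_cast hn
  constructor
  · intro h
    rw [le_div_iff₀ hn'] at h
    refine binomial_bound_aux μ n hn p hp0 hp1 B hBmeas hB
      (fun i => max ((i : ℝ) - (k : ℝ)) 0) ε' hε' fun i => ?_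
    have := pos_part_aux ((i : ℝ) - n * p) (k - n * p) (n * ε') (by positivity) (by linarith)
    calc _ = max ((i : ℝ) - n * p - (k - n * p)) 0 := by ring_nf
      _ ≤ _ := this
      _ = _ := by ring
  · intro h
    rw [div_le_iff₀ hn'] at h
    refine binomial_bound_aux μ n hn p hp0 hp1 B hBmeas hB
      (fun i => max ((k : ℝ) - (i : ℝ)) 0) ε' hε' fun i => ?_
    have := pos_part_aux (n * p - (i : ℝ)) (n * p - k) (n * ε') (by positivity) (by linarith)
    calc _ = max (n * p - (i : ℝ) - (n * p - k)) 0 := by ring_nf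
      _ ≤ _ := this

end MultiSecretary
end
end
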